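/- Let K be a field and A a finite dimensional K-algebra. A torsion class 𝒯 in mod A is bicompact and numerically disjoint if and only if 𝒯 is functorially finite. -/

import Mathlib

namespace TorsPaper

variable (A : Type) [Ring A]

/-- `N` is (isomorphic to) a factor module of `M`. -/
def IsQuotientOf (N M : ModuleCat.{0} A) : Prop :=
  ∃ f : M →ₗ[A] N, Function.Surjective f

/-- `L` is (isomorphic to) a submodule of `M`. -/
def IsSubmoduleOf (L M : ModuleCat.{0} A) : Prop :=
  ∃ f : L →ₗ[A] M, Function.Injective f

/-- `M` is a nonzero module. -/
def Nonzero (M : ModuleCat.{0} A) : Prop := ∃ x : M, x ≠ 0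

/-- A torsion class in `mod A`: a class of finitely generated modules, containing the zero
modules, closed under isomorphisms (which follows from `quot`), factor modules and
extensions. -/
structure IsTorsionClass (T : ModuleCat.{0} A → Prop) : Prop where
  fin : ∀ M, T M → Module.Finite A M
  zero : ∀ M : ModuleCat.{0} A, (∀ x : M, x = 0) → T M
  quot : ∀ M N : ModuleCat.{0} A, T M → Module.Finite A N → IsQuotientOf A N M → T N
  ext : ∀ M : ModuleCat.{0} A, Module.Finite A M → ∀ N : Submodule A M,
    T (ModuleCat.of A N) → T (ModuleCat.of A (M ⧸ N)) → T M

/-- A torsion-free class in `mod A`. -/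
structure IsTorsionFreeClass (F : ModuleCat.{0} A → Prop) : Prop where
  fin : ∀ M, F M → Module.Finite A M
  zero : ∀ M : ModuleCat.{0} A, (∀ x : M, x = 0) → F M
  sub : ∀ M N : ModuleCat.{0} A, F M → Module.Finite A N → IsSubmoduleOf A N M → F N
  ext : ∀ M : ModuleCat.{0} A, Module.Finite A M → ∀ N : Submodule A M,
    F (ModuleCat.of A N) → F (ModuleCat.of A (M ⧸ N)) → F M

/-- The right Hom-perpendicular class `T^⊥` inside `mod A`. -/
def rightPerp (T : ModuleCat.{0} A → Prop) : ModuleCat.{0} A → Prop :=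
  fun X => Module.Finite A X ∧ ∀ M : ModuleCat.{0} A, T M → ∀ f : M →ₗ[A] X, f = 0

/-- The smallest torsion class containing a class `S` of modules. -/
def torsClosure (S : ModuleCat.{0} A → Prop) : ModuleCat.{0} A → Prop :=
  fun X => ∀ T : ModuleCat.{0} A → Prop, IsTorsionClass A T → (∀ Y, S Y → T Y) → T X

/-- The smallest torsion-free class containing a class `S` of modules. -/
def torfClosure (S : ModuleCat.{0} A → Prop) : ModuleCat.{0} A → Prop :=
  fun X => ∀ F : ModuleCat.{0} A → Prop, IsTorsionFreeClass A F → (∀ Y, S Y → F Y) → F X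

/-- A torsion class is compact if it is the smallest torsion class containing a single
module `M`. -/
def IsCompactTors (T : ModuleCat.{0} A → Prop) : Prop :=
  ∃ M : ModuleCat.{0} A, Module.Finite A M ∧ T = torsClosure A (fun X => X = M)

/-- A torsion class is cocompact if `T^⊥` is the smallest torsion-free class containing a
single module `N`. -/
def IsCocompactTors (T : ModuleCat.{0} A → Prop) : Prop :=
  ∃ N : ModuleCat.{0} A, Module.Finite A N ∧ rightPerp A T = torfClosure A (fun X => X = N)

/-- A torsion class is bicompact if it is both compact and cocompact. -/
def IsBicompactTors (T : ModuleCat.{0} A → Prop) : Prop :=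
  IsCompactTors A T ∧ IsCocompactTors A T

/-- A class `C` of modules is functorially finite in `mod A` if every finitely generated
module has a left `C`-approximation and a right `C`-approximation. -/
def FunctoriallyFinite (C : ModuleCat.{0} A → Prop) : Prop :=
  (∀ M : ModuleCat.{0} A, Module.Finite A M →
    ∃ (X : ModuleCat.{0} A) (f : M →ₗ[A] X), C X ∧
      ∀ Y : ModuleCat.{0} A, C Y → ∀ g : M →ₗ[A] Y, ∃ h : X →ₗ[A] Y, h.comp f = g) ∧
  (∀ M : ModuleCat.{0} A, Module.Finite A M →
    ∃ (X : ModuleCat.{0} A) (f : X →ₗ[A] M), C X ∧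
      ∀ Y : ModuleCat.{0} A, C Y → ∀ g : Y →ₗ[A] M, ∃ h : Y →ₗ[A] X, f.comp h = g)

/-- A stability function: a real-valued function on `mod A` which is additive on short
exact sequences. -/
def IsStability (θ : ModuleCat.{0} A → ℝ) : Prop :=
  ∀ L M N : ModuleCat.{0} A, Module.Finite A L → Module.Finite A M → Module.Finite A N →
    ∀ (f : L →ₗ[A] M) (g : M →ₗ[A] N), Function.Injective f → Function.Surjective g →
      LinearMap.range f = LinearMap.ker g → θ M = θ L + θ N

/-- The semistable torsion class `T_θ`. -/
def tTheta (θ : ModuleCat.{0} A → ℝ) : ModuleCat.{0} A → Prop :=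
  fun M => Module.Finite A M ∧ ∀ N : ModuleCat.{0} A, Module.Finite A N →
    IsQuotientOf A N M → Nonzero A N → 0 < θ N

/-- The semistable torsion class `\bar T_θ`. -/
def tThetaBar (θ : ModuleCat.{0} A → ℝ) : ModuleCat.{0} A → Prop :=
  fun M => Module.Finite A M ∧ ∀ N : ModuleCat.{0} A, Module.Finite A N →
    IsQuotientOf A N M → 0 ≤ θ N

/-- The semistable torsion-free class `F_θ`. -/
def fTheta (θ : ModuleCat.{0} A → ℝ) : ModuleCat.{0} A → Prop :=
  fun M => Module.Finite A M ∧ ∀ L : ModuleCat.{0} A, Module.Finite A L →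
    IsSubmoduleOf A L M → Nonzero A L → θ L < 0

/-- The semistable torsion-free class `\bar F_θ`. -/
def fThetaBar (θ : ModuleCat.{0} A → ℝ) : ModuleCat.{0} A → Prop :=
  fun M => Module.Finite A M ∧ ∀ L : ModuleCat.{0} A, Module.Finite A L →
    IsSubmoduleOf A L M → θ L ≤ 0

/-- An integer-valued function on `mod A` additive on short exact sequences; these are
exactly the group homomorphisms `K0(mod A) → ℤ`. -/
def IsAdditiveZ (φ : ModuleCat.{0} A → ℤ) : Prop :=
  ∀ L M N : ModuleCat.{0} A, Module.Finite A L → Module.Finite A M → Module.Finite A N →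
    ∀ (f : L →ₗ[A] M) (g : M →ₗ[A] N), Function.Injective f → Function.Surjective g →
      LinearMap.range f = LinearMap.ker g → φ M = φ L + φ N

/-- `[X] = [Y]` in the Grothendieck group `K0(mod A)`: since `K0(mod A)` is free abelian
on the simple modules, this holds iff all additive `ℤ`-valued functions agree on `X`, `Y`. -/
def SameK0Class (X Y : ModuleCat.{0} A) : Prop :=
  ∀ φ : ModuleCat.{0} A → ℤ, IsAdditiveZ A φ → φ X = φ Y

/-- Two classes of modules are numerically disjoint if they contain no nonzero `X`, `Y`
with `[X] = [Y] ≠ 0` in `K0(mod A)`. -/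
def NumericallyDisjoint (C D : ModuleCat.{0} A → Prop) : Prop :=
  ¬ ∃ X Y : ModuleCat.{0} A, C X ∧ D Y ∧ Nonzero A X ∧ Nonzero A Y ∧ SameK0Class A X Y

/-- A brick: a finitely generated module whose endomorphism algebra is a division algebra,
i.e. `M` is nonzero and every nonzero endomorphism is invertible. -/
def IsBrick (M : ModuleCat.{0} A) : Prop :=
  Module.Finite A M ∧ Nonzero A M ∧ ∀ f : M →ₗ[A] M, f ≠ 0 → Function.Bijective f

/-- A semibrick: a set of pairwise Hom-orthogonal bricks. -/
def IsSemibrick (S : Set (ModuleCat.{0} A)) : Prop :=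
  (∀ M ∈ S, IsBrick A M) ∧
    ∀ M ∈ S, ∀ N ∈ S, M ≠ N → ∀ f : M →ₗ[A] N, f = 0



theorem exists_poly_vanish {K : Type} [Field K] {ι σ : Type} [Fintype ι] [Fintype σ]
    (h : Fintype.card σ < Fintype.card ι) (Φ : ι → MvPolynomial σ K) :
    ∃ G : MvPolynomial ι K, G ≠ 0 ∧ ∀ p : σ → K,
      MvPolynomial.eval (fun i => MvPolynomial.eval p (Φ i)) G = 0 := by
  have hn : ¬ AlgebraicIndependent K Φ := by
    intro hi
    have h1 := hi.cardinalMk_le_trdeg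
    rw [MvPolynomial.trdeg_of_isDomain] at h1
    simp at h1
    omega
  rw [AlgebraicIndependent, injective_iff_map_eq_zero] at hn
  push Not at hn
  obtain ⟨G, hG, hG0⟩ := hn
  refine ⟨G, hG0, fun p => ?_⟩
  have := congrArg (MvPolynomial.eval p) hG
  rw [map_zero] at this
  rw [← this, MvPolynomial.aeval_def, MvPolynomial.eval₂_eq', MvPolynomial.eval_eq', map_sum]
  simp [map_prod]

/-- `B` is covered by at most `k` polynomial images of affine spaces of dimension at most `m`. -/
def Covered {K : Type} [Field K] {ι : Type} (k m : ℕ) (B : Set (ι → K)) : Prop :=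
  ∃ (κ : Type) (_ : Fintype κ) (σ : κ → Type) (_ : ∀ j, Fintype (σ j))
    (Φ : ∀ j, ι → MvPolynomial (σ j) K),
    Fintype.card κ ≤ k ∧ (∀ j, Fintype.card (σ j) ≤ m) ∧
    ∀ f ∈ B, ∃ j, ∃ p : σ j → K, ∀ i, f i = MvPolynomial.eval p (Φ j i)

theorem Covered.exists_not_mem {K : Type} [Field K] {ι : Type} [Fintype ι] {k m : ℕ}
    {B : Set (ι → K)} (h : Covered k m B) (r : ℕ) (hr : m + r ≤ Fintype.card ι) (hk : k < 2 ^ r) :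
    ∃ f, f ∉ B := by
  classical
  obtain ⟨κ, _, σ, _, Φ, hκ, hσ, hB⟩ := h
  by_contra hcon
  push Not at hcon
  rcases finite_or_infinite K with hfin | hinf
  · have := Fintype.ofFinite K
    have hsurj : Function.Surjective
        (fun x : (Σ j : κ, (σ j → K)) => fun i => MvPolynomial.eval x.2 (Φ x.1 i)) := by
      intro f
      obtain ⟨j, p, hp⟩ := hB f (hcon f)
      exact ⟨⟨j, p⟩, by ext i; simp [hp i]⟩
    have h1 := Fintype.card_le_of_surjective _ hsurj
    rw [Fintype.card_sigma] at h1
    simp only [Fintype.card_fun] at h1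
    have hq : 2 ≤ Fintype.card K := Fintype.one_lt_card
    set q := Fintype.card K
    have h2 : ∑ j : κ, q ^ Fintype.card (σ j) ≤ k * q ^ m := by
      calc ∑ j : κ, q ^ Fintype.card (σ j) ≤ ∑ j : κ, q ^ m :=
            Finset.sum_le_sum fun j _ => Nat.pow_le_pow_right (by omega) (hσ j)
        _ = Fintype.card κ * q ^ m := by simp
        _ ≤ _ := Nat.mul_le_mul_right _ hκ
    have h3 : k * q ^ m < q ^ Fintype.card ι := by
      calc k * q ^ m < 2 ^ r * q ^ m := Nat.mul_lt_mul_of_pos_right hk (by positivity)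
        _ ≤ q ^ r * q ^ m := Nat.mul_le_mul_right _ (Nat.pow_le_pow_left hq r)
        _ = q ^ (m + r) := by rw [← pow_add, add_comm]
        _ ≤ _ := Nat.pow_le_pow_right (by omega) hr
    omega
  · have hpos : 0 < k := by
      obtain ⟨j, _⟩ := hB 0 (hcon 0)
      exact lt_of_lt_of_le (Fintype.card_pos_iff.mpr ⟨j⟩) hκ
    have hr0 : 0 < r := by
      rcases Nat.eq_zero_or_pos r with h | h
      · subst h; simp at hk; omega
      · exact h
    have := fun j => exists_poly_vanish (K := K) (ι := ι) (σ := σ j)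
      (by have := hσ j; omega) (Φ j)
    choose G hG0 hG using this
    have hprod : ∏ j, G j ≠ 0 := Finset.prod_ne_zero_iff.mpr fun j _ => hG0 j
    apply hprod
    apply MvPolynomial.funext
    intro f
    obtain ⟨j, p, hp⟩ := hB f (hcon f)
    rw [map_prod, map_zero]
    apply Finset.prod_eq_zero (Finset.mem_univ j)
    have : f = fun i => MvPolynomial.eval p (Φ j i) := funext hp
    rw [this]
    exact hG j p

theorem Covered.union {K : Type} [Field K] {ι : Type} {k k' m : ℕ} {B B' : Set (ι → K)}
    (h : Covered k m B) (h' : Covered k' m B') : Covered (k + k') m (B ∪ B') := by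
  obtain ⟨κ, _, σ, _, Φ, hκ, hσ, hB⟩ := h
  obtain ⟨κ', _, σ', _, Φ', hκ', hσ', hB'⟩ := h'
  refine ⟨κ ⊕ κ', inferInstance, Sum.elim σ σ', fun j => ?_, fun j => ?_, ?_, ?_, ?_⟩
  · cases j <;> simp only [Sum.elim_inl, Sum.elim_inr] <;> infer_instance
  · cases j with
    | inl j => exact Φ j
    | inr j => exact Φ' j
  · rw [Fintype.card_sum]; omega
  · rintro (j | j)
    · exact hσ j
    · exact hσ' j
  · rintro f (hf | hf)
    · obtain ⟨j, p, hp⟩ := hB f hf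
      exact ⟨Sum.inl j, p, hp⟩
    · obtain ⟨j, p, hp⟩ := hB' f hf
      exact ⟨Sum.inr j, p, hp⟩

theorem Covered.reindex {K : Type} [Field K] {ι ι' : Type} {k m : ℕ} {B : Set (ι → K)}
    (h : Covered k m B) (e : ι' → ι) (B' : Set (ι' → K))
    (hB' : ∀ f ∈ B', ∃ g ∈ B, ∀ i, f i = g (e i)) : Covered k m B' := by
  obtain ⟨κ, _, σ, _, Φ, hκ, hσ, hB⟩ := h
  refine ⟨κ, inferInstance, σ, inferInstance, fun j i => Φ j (e i), hκ, hσ, fun f hf => ?_⟩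
  obtain ⟨g, hg, hfg⟩ := hB' f hf
  obtain ⟨j, p, hp⟩ := hB g hg
  exact ⟨j, p, fun i => by rw [hfg, hp]⟩

theorem exists_span_family {K V : Type} [Field K] [AddCommGroup V] [Module K V]
    [FiniteDimensional K V] (Z : Submodule K V) (b : ℕ) (hb : Module.finrank K Z ≤ b) :
    ∃ z : Fin b → V, ∀ g ∈ Z, ∃ a : Fin b → K, g = ∑ l, a l • z l := by
  let B := Module.finBasis K Z
  let z : Fin b → V := fun l =>
    if h : (l : ℕ) < Module.finrank K Z then (B ⟨l, h⟩ : V) else 0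
  have hz : Z ≤ Submodule.span K (Set.range z) := by
    intro g hg
    have h1 := B.sum_repr ⟨g, hg⟩
    have h2 := congrArg Subtype.val h1
    simp only [Submodule.coe_sum, Submodule.coe_smul] at h2
    rw [← h2]
    refine Submodule.sum_mem _ fun i _ => Submodule.smul_mem _ _ (Submodule.subset_span ?_)
    exact ⟨Fin.castLE hb i, by simp [z]⟩
  refine ⟨z, fun g hg => ?_⟩
  obtain ⟨a, ha⟩ := (Submodule.mem_span_range_iff_exists_fun K).mp (hz hg)
  exact ⟨a, ha.symm⟩



theorem exists_fun_image {n : ℕ} (d : ℕ) (J : Finset (Fin n)) (h1 : 0 < J.card) (h2 : J.card ≤ d) :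
    ∃ a : Fin d → Fin n, Finset.univ.image a = J := by
  classical
  obtain ⟨j0, hj0⟩ := Finset.card_pos.mp h1
  refine ⟨fun l => if h : (l : ℕ) < J.card then (J.equivFin.symm ⟨l, h⟩ : Fin n) else j0, ?_⟩
  ext i
  simp only [Finset.mem_image, Finset.mem_univ, true_and]
  constructor
  · rintro ⟨l, rfl⟩
    split_ifs with h
    · exact (J.equivFin.symm ⟨l, h⟩).2
    · exact hj0
  · intro hi
    refine ⟨⟨J.equivFin ⟨i, hi⟩, lt_of_lt_of_le (Fin.is_lt _) h2⟩, ?_⟩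
    simp

theorem chart_card (n e d : ℕ) (J : Finset (Fin n)) (b : ℕ) (hb : b + J.card + 1 = J.card * e)
    (hJ : J.card ≤ d) :
    Fintype.card (({i // i ∉ J} × {i // i ∈ J}) ⊕ (Fin n × {i // i ∉ J} × Fin e) ⊕
      (Fin n × Fin b) ⊕ (Fin b × {i // i ∈ J} × Fin e)) + n ≤ n * n * e + (d * e) ^ 2 := by
  classical
  have h1 : Fintype.card {i // i ∈ J} = J.card := by simp
  have h2 : Fintype.card {i // i ∉ J} = n - J.card := by
    rw [Fintype.card_subtype_compl]; simp
  have h3 : J.card ≤ n := by simpa using Finset.card_le_univ J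
  simp only [Fintype.card_sum, Fintype.card_prod, h1, h2, Fintype.card_fin]
  obtain ⟨r, hr⟩ := Nat.exists_eq_add_of_le h3
  have h4 : n - J.card = r := by omega
  rw [h4]
  generalize J.card = u at *
  have h5 : b * (u * e) ≤ (d * e) ^ 2 := by
    rw [sq]
    exact Nat.mul_le_mul (by have := Nat.mul_le_mul_right e hJ; omega) (Nat.mul_le_mul_right e hJ)
  have h6 : n * (b + u + 1) = n * (u * e) := by rw [hb]
  subst hr
  nlinarith [h5, h6, Nat.zero_le (u*u)]

theorem bad_covered {K E V W : Type} [Field K] [AddCommGroup E] [Module K E]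
    [AddCommGroup V] [Module K V] [AddCommGroup W] [Module K W]
    [FiniteDimensional K E] [FiniteDimensional K V] [FiniteDimensional K W]
    (β : E →ₗ[K] V →ₗ[K] W)
    (hβ : ∀ U : Submodule K V, U ≠ ⊥ →
      Module.finrank K U < Module.finrank K (Submodule.map₂ β ⊤ U))
    {e : ℕ} (bE : Module.Basis (Fin e) K E) (n m : ℕ)
    (hm : n * n * e + (Module.finrank K V * e) ^ 2 ≤ m + n) :
    Covered (n ^ Module.finrank K V) m
      {f : Fin n × Fin n × Fin e → K | ∃ v : Fin n → V, v ≠ 0 ∧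
        ∀ i', ∑ i, β (∑ t, f (i', i, t) • bE t) (v i) = 0} := by
  classical
  set d := Module.finrank K V with hd
  let good : Finset (Fin n) → Prop := fun J => 0 < J.card ∧ J.card + 1 ≤ J.card * e
  let κ := {a : Fin d → Fin n // good (Finset.univ.image a)}
  let J : κ → Finset (Fin n) := fun a => Finset.univ.image a.1
  let b : κ → ℕ := fun a => (J a).card * e - (J a).card - 1
  let σ : κ → Type := fun a => ({i // i ∉ J a} × {i // i ∈ J a}) ⊕
    (Fin n × {i // i ∉ J a} × Fin e) ⊕
      (Fin n × Fin (b a)) ⊕ (Fin (b a) × {i // i ∈ J a} × Fin e)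
  let xc : ∀ a : κ, {i // i ∉ J a} → {i // i ∈ J a} → MvPolynomial (σ a) K :=
    fun a i j => MvPolynomial.X (Sum.inl (i, j))
  let xf : ∀ a : κ, Fin n → {i // i ∉ J a} → Fin e → MvPolynomial (σ a) K :=
    fun a i' i t => MvPolynomial.X (Sum.inr (Sum.inl (i', i, t)))
  let xa : ∀ a : κ, Fin n → Fin (b a) → MvPolynomial (σ a) K :=
    fun a i' l => MvPolynomial.X (Sum.inr (Sum.inr (Sum.inl (i', l))))
  let xz : ∀ a : κ, Fin (b a) → {i // i ∈ J a} → Fin e → MvPolynomial (σ a) K :=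
    fun a l j t => MvPolynomial.X (Sum.inr (Sum.inr (Sum.inr (l, j, t))))
  refine ⟨κ, inferInstance, σ, fun a => by dsimp only [σ]; infer_instance,
    fun a x => if h : x.2.1 ∈ J a then
        ∑ l, xa a x.1 l * xz a l ⟨x.2.1, h⟩ x.2.2
          - ∑ i2, xc a i2 ⟨x.2.1, h⟩ * xf a x.1 i2 x.2.2
      else xf a x.1 ⟨x.2.1, h⟩ x.2.2, ?_, ?_, ?_⟩
  · refine (Fintype.card_subtype_le _).trans ?_
    simp
  · intro a
    have hg : good (J a) := a.2
    have hc := chart_card n e d (J a) (b a) (by have := hg.2; dsimp only [b]; omega)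
      (Finset.card_image_le.trans (by simp))
    have hc' : Fintype.card (σ a) + n ≤ n * n * e + (d * e) ^ 2 := by
      convert hc
    omega
  · rintro f ⟨v, hv0, hv⟩
    obtain ⟨s, -, -, hs, hli⟩ := exists_linearIndepOn_extension (K := K) (v := v)
      (s := ∅) (t := Set.univ) (linearIndepOn_empty K v) (Set.subset_univ _)
    obtain ⟨J0, hsJ⟩ : ∃ J0 : Finset (Fin n), ∀ i, i ∈ J0 ↔ i ∈ s :=
      ⟨s.toFinset, fun i => Set.mem_toFinset⟩
    let w : {i // i ∈ J0} → V := fun j => v j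
    have hw : LinearIndependent K w := by
      have := hli.comp (fun j : {i // i ∈ J0} => (⟨j.1, (hsJ _).1 j.2⟩ : s))
        (fun x y h => Subtype.ext (congrArg (fun q : s => (q : Fin n)) h))
      exact this
    let U := Submodule.span K (Set.range w)
    have hvU : ∀ i, v i ∈ U := by
      intro i
      have h1 : v i ∈ Submodule.span K (v '' s) := hs ⟨i, Set.mem_univ _, rfl⟩
      refine Submodule.span_mono ?_ h1
      rintro _ ⟨j, hj, rfl⟩
      exact ⟨⟨j, (hsJ j).2 hj⟩, rfl⟩
    have hU0 : U ≠ ⊥ := by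
      intro h
      apply hv0
      ext i
      have := hvU i
      rw [h] at this
      simpa using this
    have hUc : Module.finrank K U = J0.card := by
      rw [finrank_span_eq_card hw]; simp
    have hexp := hβ U hU0
    let Ψ : ({i // i ∈ J0} → E) →ₗ[K] W :=
      ∑ j, (β.flip (w j)).comp (LinearMap.proj j)
    have hΨ : ∀ g, Ψ g = ∑ j, β (g j) (w j) := fun g => by simp [Ψ]
    have hrange : Submodule.map₂ β ⊤ U ≤ LinearMap.range Ψ := by
      rw [Submodule.map₂_le]
      intro x _ u hu
      obtain ⟨c, hc⟩ := (Submodule.mem_span_range_iff_exists_fun K).mp hu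
      refine ⟨fun j => c j • x, ?_⟩
      rw [hΨ, ← hc, map_sum]
      simp
    have hfr := Submodule.finrank_mono hrange
    have hrk := Ψ.finrank_range_add_finrank_ker
    rw [Module.finrank_pi_fintype] at hrk
    simp only [Module.finrank_eq_card_basis bE, Fintype.card_fin, Finset.sum_const,
      Finset.card_univ, Fintype.card_coe, smul_eq_mul] at hrk
    have hJ1 : J0.card + 1 ≤ J0.card * e := by omega
    have hJ0 : 0 < J0.card := by
      rw [← hUc]
      exact Nat.pos_of_ne_zero fun h => hU0 (Submodule.finrank_eq_zero.mp h)
    have hJd : J0.card ≤ d := by rw [← hUc]; exact Submodule.finrank_le U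
    obtain ⟨a, haJ⟩ : ∃ a : κ, J a = J0 := by
      obtain ⟨a0, ha0⟩ := exists_fun_image d J0 hJ0 hJd
      exact ⟨⟨a0, by rw [ha0]; exact ⟨hJ0, hJ1⟩⟩, ha0⟩
    subst haJ
    obtain ⟨z, hz⟩ := exists_span_family (LinearMap.ker Ψ) (b a) (by dsimp only [b]; omega)
    have hc : ∀ i : {i // i ∉ J a}, ∃ c : {i // i ∈ J a} → K, ∑ j, c j • w j = v i := fun i =>
      (Submodule.mem_span_range_iff_exists_fun K).mp (hvU i)
    choose c hc using hc
    let el : Fin n → Fin n → E := fun i' i => ∑ t, f (i', i, t) • bE t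
    have hel : ∀ i' i t, bE.repr (el i' i) t = f (i', i, t) := by
      intro i' i t
      dsimp only [el]
      rw [bE.repr_sum_self]
    let g : Fin n → {i // i ∈ J a} → E := fun i' j => el i' j + ∑ i2, c i2 j • el i' i2
    have hg : ∀ i', g i' ∈ LinearMap.ker Ψ := by
      intro i'
      rw [LinearMap.mem_ker, hΨ, ← hv i']
      simp only [g, map_add, LinearMap.add_apply, Finset.sum_add_distrib]
      rw [← Fintype.sum_subtype_add_sum_subtype (fun i => i ∈ J a)]
      refine congrArg₂ (· + ·) (Finset.sum_congr (by ext; simp) (fun _ _ => rfl)) ?_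
      change _ = ∑ i2 : {i // i ∉ J a}, β (el i' i2) (v i2)
      simp only [map_sum, LinearMap.sum_apply, map_smul, LinearMap.smul_apply]
      rw [Finset.sum_comm]
      refine Finset.sum_congr rfl fun i2 _ => ?_
      rw [← hc i2, map_sum]
      simp
    choose co hco using fun i' => hz (g i') (hg i')
    refine ⟨a, Sum.elim (fun x => c x.1 x.2) (Sum.elim (fun x => f (x.1, x.2.1, x.2.2))
      (Sum.elim (fun x => co x.1 x.2) (fun x => bE.repr (z x.1 x.2.1) x.2.2))), ?_⟩
    rintro ⟨i', i, t⟩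
    by_cases h : i ∈ J a
    · have h1 := congrFun (hco i') ⟨i, h⟩
      have h2 := congrArg (fun y => bE.repr y t) h1
      simp only [g, map_add, map_sum, map_smul, Finsupp.add_apply, Finsupp.coe_finsetSum,
        Finset.sum_apply, Finsupp.smul_apply, hel, smul_eq_mul, Pi.smul_apply] at h2
      simp only [h, dite_true, map_sub, map_sum, map_mul, xa, xz, xc, xf, MvPolynomial.eval_X,
        Sum.elim_inl, Sum.elim_inr]
      rw [eq_sub_iff_add_eq]
      exact h2
    · simp only [h, dite_false, xf, MvPolynomial.eval_X, Sum.elim_inl, Sum.elim_inr]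

theorem exists_large (k d c : ℕ) : ∃ n : ℕ, ∃ r : ℕ, c + r = n ∧ k * n ^ d < 2 ^ r := by
  have h := (tendsto_pow_const_div_const_pow_of_one_lt d (r := (2:ℝ)) (by norm_num)).const_mul
    ((k : ℝ) * 2 ^ c)
  rw [mul_zero] at h
  obtain ⟨n, hn, hnc⟩ := ((h.eventually (gt_mem_nhds (show (0:ℝ) < 1 by norm_num))).and
    (Filter.eventually_ge_atTop c)).exists
  obtain ⟨r, hr⟩ := Nat.exists_eq_add_of_le hnc
  refine ⟨n, r, hr.symm, ?_⟩
  rw [← mul_div_assoc, div_lt_one (by positivity)] at hn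
  have h3 : (2:ℝ) ^ n = 2 ^ c * 2 ^ r := by rw [hr, pow_add]
  rw [h3] at hn
  have : (k : ℝ) * n ^ d < 2 ^ r := by
    have h4 : (0:ℝ) < 2 ^ c := by positivity
    nlinarith
  exact_mod_cast this


section Hom
variable {A : Type} [Ring A] (K : Type) [Field K] [Algebra K A]

/-- The `K`-structure on an `A`-module. -/
@[reducible] def kMod (X : Type) [AddCommGroup X] [Module A X] : Module K X :=
  Module.compHom X (algebraMap K A)

theorem kTower (X : Type) [AddCommGroup X] [Module A X] :
    letI := kMod (A := A) K X
    IsScalarTower K A X := by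
  letI := kMod (A := A) K X
  refine ⟨fun k a x => ?_⟩
  change (k • a) • x = algebraMap K A k • (a • x)
  rw [Algebra.smul_def, mul_smul]

/-- The `K`-dimension of `Hom_A(P, X)`. -/
noncomputable def hd (P X : Type) [AddCommGroup P] [Module A P] [AddCommGroup X] [Module A X] : ℕ :=
  letI := kMod (A := A) K X
  haveI := kTower (A := A) K X
  Module.finrank K (P →ₗ[A] X)

theorem hd_eq (P X : Type) [AddCommGroup P] [Module A P] [AddCommGroup X] [Module A X]
    [h : Module K X] [IsScalarTower K A X] :
    hd (A := A) K P X = Module.finrank K (P →ₗ[A] X) := by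
  have : h = kMod (A := A) K X := by
    refine Module.ext' _ _ fun k x => ?_
    change k • x = algebraMap K A k • x
    rw [algebraMap_smul]
  subst this
  rfl

/-- Postcomposition as a `K`-linear map. -/
def postc {P X Y : Type} [AddCommGroup P] [Module A P] [AddCommGroup X] [Module A X]
    [AddCommGroup Y] [Module A Y] [Module K X] [IsScalarTower K A X] [Module K Y]
    [IsScalarTower K A Y] (f : X →ₗ[A] Y) : (P →ₗ[A] X) →ₗ[K] (P →ₗ[A] Y) where
  toFun u := f.comp u
  map_add' u v := by ext; simp
  map_smul' k u := by ext x; simp [f.map_smul_of_tower]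

/-- Precomposition as a `K`-linear map. -/
def prec {P Q X : Type} [AddCommGroup P] [Module A P] [AddCommGroup Q] [Module A Q]
    [AddCommGroup X] [Module A X] [Module K X] [IsScalarTower K A X]
    (f : P →ₗ[A] Q) : (Q →ₗ[A] X) →ₗ[K] (P →ₗ[A] X) where
  toFun u := u.comp f
  map_add' u v := by ext; simp
  map_smul' k u := by ext x; simp

variable [FiniteDimensional K A]

theorem noeth (K : Type) [Field K] [Algebra K A] [FiniteDimensional K A] : IsNoetherianRing A := IsNoetherianRing.of_finite K A

theorem artin (K : Type) [Field K] [Algebra K A] [FiniteDimensional K A] : IsArtinianRing A := IsArtinianRing.of_finite K A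

theorem finK (X : Type) [AddCommGroup X] [Module A X] [Module K X] [IsScalarTower K A X]
    [Module.Finite A X] : Module.Finite K X := Module.Finite.trans A X

theorem homFinite (P X : Type) [AddCommGroup P] [Module A P] [AddCommGroup X] [Module A X]
    [Module K X] [IsScalarTower K A X] [Module.Finite A P] [Module.Finite A X] :
    Module.Finite K (P →ₗ[A] X) := by
  letI := kMod (A := A) K P
  haveI := kTower (A := A) K P
  haveI := finK (A := A) K P
  haveI := finK (A := A) K X
  exact Module.Finite.of_injective (LinearMap.restrictScalarsₗ K A P X K)
    (LinearMap.restrictScalars_injective K)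

theorem hd_add {P L M N : Type} [AddCommGroup P] [Module A P] [AddCommGroup L] [Module A L]
    [AddCommGroup M] [Module A M] [AddCommGroup N] [Module A N] [Module.Finite A P]
    [Module.Projective A P] [Module.Finite A M] (f : L →ₗ[A] M) (g : M →ₗ[A] N)
    (hf : Function.Injective f) (hg : Function.Surjective g)
    (hfg : LinearMap.range f = LinearMap.ker g) :
    hd (A := A) K P M = hd (A := A) K P L + hd (A := A) K P N := by
  letI := kMod (A := A) K L
  haveI := kTower (A := A) K L
  letI := kMod (A := A) K M
  haveI := kTower (A := A) K M
  letI := kMod (A := A) K N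
  haveI := kTower (A := A) K N
  rw [hd_eq, hd_eq, hd_eq]
  haveI := homFinite (A := A) K P M
  have h1 := (postc (A := A) (P := P) K g).finrank_range_add_finrank_ker
  have h2 : LinearMap.range (postc (A := A) (P := P) K g) = ⊤ := by
    rw [LinearMap.range_eq_top]
    intro u
    obtain ⟨v, hv⟩ := Module.projective_lifting_property g u hg
    exact ⟨v, hv⟩
  have h3 : LinearMap.ker (postc (A := A) (P := P) K g) =
      LinearMap.range (postc (A := A) (P := P) K f) := by
    ext u
    constructor
    · intro hu
      have hu' : ∀ x, u x ∈ LinearMap.range f := fun x => by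
        rw [hfg]; exact LinearMap.congr_fun hu x
      refine ⟨(LinearEquiv.ofInjective f hf).symm.toLinearMap.comp (u.codRestrict _ hu'), ?_⟩
      ext x
      change f ((LinearEquiv.ofInjective f hf).symm ⟨u x, hu' x⟩) = u x
      exact congrArg Subtype.val ((LinearEquiv.ofInjective f hf).apply_symm_apply ⟨u x, hu' x⟩)
    · rintro ⟨v, rfl⟩
      rw [LinearMap.mem_ker]
      ext x
      change g (f (v x)) = 0
      have : f (v x) ∈ LinearMap.ker g := by rw [← hfg]; exact ⟨_, rfl⟩
      exact this
  have h4 : Function.Injective (postc (A := A) (P := P) K f) := by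
    intro u v huv
    ext x
    exact hf (LinearMap.congr_fun huv x)
  rw [h2, finrank_top, h3, LinearMap.finrank_range_of_inj h4] at h1
  omega

theorem hd_sub_quot {P M : Type} [AddCommGroup P] [Module A P]
    [AddCommGroup M] [Module A M] [Module.Finite A P]
    [Module.Projective A P] [Module.Finite A M] (L : Submodule A M) :
    hd (A := A) K P M = hd (A := A) K P L + hd (A := A) K P (M ⧸ L) :=
  hd_add K L.subtype L.mkQ (Submodule.injective_subtype L) (Submodule.mkQ_surjective L) (by simp)

theorem hd_zero_iff {P X : Type} [AddCommGroup P] [Module A P] [AddCommGroup X] [Module A X]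
    [Module.Finite A P] [Module.Finite A X] :
    hd (A := A) K P X = 0 ↔ ∀ u : P →ₗ[A] X, u = 0 := by
  letI := kMod (A := A) K X
  haveI := kTower (A := A) K X
  haveI := homFinite (A := A) K P X
  rw [hd_eq, Module.finrank_zero_iff]
  exact ⟨fun h u => Subsingleton.elim _ _, fun h => ⟨fun a b => by rw [h a, h b]⟩⟩

theorem hd_ring_zero_iff {X : Type} [AddCommGroup X] [Module A X] [Module.Finite A X] :
    hd (A := A) K A X = 0 ↔ ∀ x : X, x = 0 := by
  rw [hd_zero_iff]
  constructor
  · intro h x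
    have := LinearMap.congr_fun (h (LinearMap.toSpanSingleton A X x)) 1
    simpa using this
  · intro h u
    ext
    exact h _

theorem hd_congr_left {P Q X : Type} [AddCommGroup P] [Module A P] [AddCommGroup Q] [Module A Q]
    [AddCommGroup X] [Module A X] (e : P ≃ₗ[A] Q) : hd (A := A) K P X = hd (A := A) K Q X := by
  letI := kMod (A := A) K X
  haveI := kTower (A := A) K X
  rw [hd_eq, hd_eq]
  refine LinearEquiv.finrank_eq (LinearEquiv.ofBijective (prec (A := A) K e.symm.toLinearMap) ?_)
  constructor
  · intro u v h
    ext x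
    have := LinearMap.congr_fun h (e x)
    simpa [prec] using this
  · intro u
    exact ⟨u.comp e.toLinearMap, by ext x; simp [prec]⟩

theorem hd_congr_right {P X Y : Type} [AddCommGroup P] [Module A P] [AddCommGroup X] [Module A X]
    [AddCommGroup Y] [Module A Y] (e : X ≃ₗ[A] Y) : hd (A := A) K P X = hd (A := A) K P Y := by
  letI := kMod (A := A) K X
  haveI := kTower (A := A) K X
  letI := kMod (A := A) K Y
  haveI := kTower (A := A) K Y
  rw [hd_eq, hd_eq]
  refine LinearEquiv.finrank_eq (LinearEquiv.ofBijective (postc (A := A) K e.toLinearMap) ?_)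
  constructor
  · intro u v h
    ext x
    have := LinearMap.congr_fun h x
    simpa [postc] using this
  · intro u
    exact ⟨e.symm.toLinearMap.comp u, by ext x; simp [postc]⟩

theorem hd_prod_left {P Q X : Type} [AddCommGroup P] [Module A P] [AddCommGroup Q] [Module A Q]
    [AddCommGroup X] [Module A X] [Module.Finite A P] [Module.Finite A Q] [Module.Finite A X] :
    hd (A := A) K (P × Q) X = hd (A := A) K P X + hd (A := A) K Q X := by
  letI := kMod (A := A) K X
  haveI := kTower (A := A) K X
  haveI := homFinite (A := A) K P X
  haveI := homFinite (A := A) K Q X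
  rw [hd_eq, hd_eq, hd_eq, ← Module.finrank_prod]
  exact (LinearMap.coprodEquiv (R := A) K).finrank_eq.symm

/-- Projective covers exist. -/
theorem exists_cover (K : Type) [Field K] [Algebra K A] [FiniteDimensional K A]
    (Ω : Type) [AddCommGroup Ω] [Module A Ω] [Module.Finite A Ω] :
    ∃ (P : ModuleCat.{0} A) (π : P →ₗ[A] Ω), Module.Finite A P ∧ Module.Projective A P ∧
      Function.Surjective π ∧ ∀ L : Submodule A P, Submodule.map π L = ⊤ → L = ⊤ := by
  haveI := artin (A := A) K
  obtain ⟨m, π, hπ⟩ := Module.Finite.exists_fin' A Ω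
  obtain ⟨L, hL, hmin⟩ := (wellFounded_lt (α := Submodule A (Fin m → A))).has_min
    {L | Submodule.map π L = ⊤} ⟨⊤, by simpa [LinearMap.range_eq_top] using hπ⟩
  have hL' : Submodule.map π L = ⊤ := hL
  have hsurj : Function.Surjective (π.comp L.subtype) := by
    rw [← LinearMap.range_eq_top, LinearMap.range_comp, Submodule.range_subtype, hL']
  have hmin' : ∀ L' : Submodule A (Fin m → A), L' ≤ L → Submodule.map π L' = ⊤ → L' = L := by
    intro L' h1 h2
    by_contra h3
    exact hmin L' h2 (lt_of_le_of_ne h1 h3)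
  obtain ⟨h, hh⟩ := Module.projective_lifting_property (π.comp L.subtype) π hsurj
  have hs : Function.Surjective (h.comp L.subtype) := by
    rw [← LinearMap.range_eq_top]
    have h1 : Submodule.map L.subtype (LinearMap.range (h.comp L.subtype)) = L := by
      apply hmin' _ (Submodule.map_subtype_le _ _)
      rw [← LinearMap.range_comp, ← LinearMap.range_comp, ← LinearMap.comp_assoc,
        ← LinearMap.comp_assoc, hh, LinearMap.range_eq_top]
      exact hsurj
    apply Submodule.map_injective_of_injective (Submodule.injective_subtype L)
    rw [h1, Submodule.map_subtype_top]
  have hb : Function.Bijective (h.comp L.subtype) :=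
    IsArtinian.bijective_of_injective_endomorphism _
      (IsNoetherian.injective_of_surjective_endomorphism _ hs)
  let e := LinearEquiv.ofBijective _ hb
  refine ⟨ModuleCat.of A L, π.comp L.subtype, inferInstanceAs (Module.Finite A L), ?_, hsurj, ?_⟩
  · refine Module.Projective.of_split L.subtype (e.symm.toLinearMap.comp h) ?_
    ext x
    change ((e.symm (h x) : L) : Fin m → A) _ = _
    have : h x = e x := rfl
    rw [this, e.symm_apply_apply]
    rfl
  · intro L' hL'
    have h1 : Submodule.map L.subtype L' = L := by
      apply hmin' _ (Submodule.map_subtype_le _ _)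
      rw [← Submodule.map_comp]
      exact hL'
    apply Submodule.map_injective_of_injective (Submodule.injective_subtype L)
    exact h1.trans (Submodule.map_subtype_top L).symm

end Hom

set_option linter.style.haveILetI false
section TorsLemmas
variable {A : Type} [Ring A] {T : ModuleCat.{0} A → Prop}

theorem IsTorsionClass.fin' (hT : IsTorsionClass A T) {X : Type} [AddCommGroup X] [Module A X]
    (hX : T (ModuleCat.of A X)) : Module.Finite A X := hT.fin _ hX

theorem IsTorsionClass.of_surj (hT : IsTorsionClass A T) {X Y : Type} [AddCommGroup X] [Module A X]
    [AddCommGroup Y] [Module A Y] (hX : T (ModuleCat.of A X)) (f : X →ₗ[A] Y)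
    (hf : Function.Surjective f) : T (ModuleCat.of A Y) := by
  haveI := hT.fin' hX
  have h2 : Module.Finite A Y := Module.Finite.of_surjective f hf
  exact hT.quot (ModuleCat.of A X) (ModuleCat.of A Y) hX h2 ⟨f, hf⟩

theorem IsTorsionClass.of_range (hT : IsTorsionClass A T) {X Y : Type} [AddCommGroup X] [Module A X]
    [AddCommGroup Y] [Module A Y] (hX : T (ModuleCat.of A X)) (f : X →ₗ[A] Y) :
    T (ModuleCat.of A (LinearMap.range f)) :=
  hT.of_surj hX f.rangeRestrict f.surjective_rangeRestrict

theorem IsTorsionClass.of_exact (hT : IsTorsionClass A T) {L M N : Type} [AddCommGroup L]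
    [Module A L] [AddCommGroup M] [Module A M] [AddCommGroup N] [Module A N] [Module.Finite A M]
    (hL : T (ModuleCat.of A L)) (hN : T (ModuleCat.of A N)) (f : L →ₗ[A] M) (g : M →ₗ[A] N)
    (hg : Function.Surjective g)
    (hfg : LinearMap.range f = LinearMap.ker g) : T (ModuleCat.of A M) := by
  refine hT.ext (ModuleCat.of A M) (inferInstanceAs (Module.Finite A M)) (LinearMap.range f)
    (hT.of_range hL f) ?_
  rw [hfg]
  exact hT.of_surj hN (g.quotKerEquivOfSurjective hg).symm.toLinearMap
    (g.quotKerEquivOfSurjective hg).symm.surjective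

theorem IsTorsionClass.prod (hT : IsTorsionClass A T) {L N : Type} [AddCommGroup L]
    [Module A L] [AddCommGroup N] [Module A N]
    (hL : T (ModuleCat.of A L)) (hN : T (ModuleCat.of A N)) : T (ModuleCat.of A (L × N)) := by
  haveI := hT.fin' hL
  haveI := hT.fin' hN
  exact hT.of_exact hL hN (LinearMap.inl A L N) (LinearMap.snd A L N) LinearMap.snd_surjective
    (by rw [LinearMap.range_inl])

theorem IsTorsionClass.pi (hT : IsTorsionClass A T) {L : Type} [AddCommGroup L]
    [Module A L] (hL : T (ModuleCat.of A L)) (n : ℕ) : T (ModuleCat.of A (Fin n → L)) := by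
  induction n with
  | zero => exact hT.zero _ fun x => Subsingleton.elim (α := Fin 0 → L) x 0
  | succ n ih =>
    exact hT.of_surj (hT.prod hL ih) (Fin.consLinearEquiv A (fun _ : Fin (n+1) => L)).toLinearMap
      (Fin.consLinearEquiv A (fun _ : Fin (n+1) => L)).surjective

theorem IsTorsionClass.sup (hT : IsTorsionClass A T) {X : Type} [AddCommGroup X]
    [Module A X] {S S' : Submodule A X} (hS : T (ModuleCat.of A S)) (hS' : T (ModuleCat.of A S')) :
    T (ModuleCat.of A (S ⊔ S' : Submodule A X)) := by
  have h := hT.of_range (hT.prod hS hS') (S.subtype.coprod S'.subtype)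
  rw [LinearMap.range_coprod, Submodule.range_subtype, Submodule.range_subtype] at h
  exact h

theorem IsTorsionClass.radical (hT : IsTorsionClass A T) [IsNoetherianRing A] (X : Type)
    [AddCommGroup X] [Module A X] [Module.Finite A X] :
    ∃ t : Submodule A X, T (ModuleCat.of A t) ∧
      (∀ (M : Type) [AddCommGroup M] [Module A M], T (ModuleCat.of A M) → ∀ f : M →ₗ[A] X,
        LinearMap.range f ≤ t) ∧ rightPerp A T (ModuleCat.of A (X ⧸ t)) := by
  obtain ⟨t, ht, hmax⟩ := (wellFounded_gt (α := Submodule A X)).has_min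
    {S | T (ModuleCat.of A S)} ⟨⊥, hT.zero _ fun x => Subsingleton.elim (α := (⊥ : Submodule A X)) x 0⟩
  have ht' : T (ModuleCat.of A t) := ht
  have key : ∀ S : Submodule A X, T (ModuleCat.of A S) → S ≤ t := by
    intro S hS
    by_contra hc
    exact hmax _ (hT.sup ht' hS) (lt_of_le_of_ne le_sup_left fun h => hc (h ▸ le_sup_right))
  refine ⟨t, ht', fun M _ _ hM f => key _ (hT.of_range hM f),
    inferInstanceAs (Module.Finite A (X ⧸ t)), ?_⟩
  intro M hM f
  let S : Submodule A X := (LinearMap.range (f : M →ₗ[A] (X ⧸ t))).comap t.mkQ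
  have htS : t ≤ S := by
    intro x hx
    change t.mkQ x ∈ LinearMap.range (f : M →ₗ[A] (X ⧸ t))
    have : t.mkQ x = 0 := by simpa using hx
    rw [this]; exact zero_mem _
  have hS : T (ModuleCat.of A S) := by
    let g : S →ₗ[A] LinearMap.range (f : M →ₗ[A] (X ⧸ t)) :=
      t.mkQ.restrict (p := S) (fun x hx => hx)
    refine hT.of_exact ht' (hT.of_range (X := M) hM f) (Submodule.inclusion htS) g ?_ ?_
    · rintro ⟨y, hy⟩
      obtain ⟨x, rfl⟩ := t.mkQ_surjective y
      exact ⟨⟨x, hy⟩, rfl⟩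
    · ext ⟨x, hx⟩
      constructor
      · rintro ⟨⟨y, hy⟩, h⟩
        have : y = x := congrArg Subtype.val h
        subst this
        refine Subtype.ext ?_
        change t.mkQ y = 0
        simpa using hy
      · intro h
        have : t.mkQ x = 0 := congrArg Subtype.val h
        exact ⟨⟨x, by simpa using this⟩, rfl⟩
  have hSt := key S hS
  refine LinearMap.ext fun m => ?_
  obtain ⟨x, hx⟩ := t.mkQ_surjective ((f : M →ₗ[A] (X ⧸ t)) m)
  have hxS : x ∈ S := ⟨m, hx.symm⟩
  have : t.mkQ x = 0 := by simpa using hSt hxS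
  exact hx.symm.trans this

theorem rightPerp.zero_of {X Y : Type} [AddCommGroup X] [Module A X]
    [AddCommGroup Y] [Module A Y] (hY : rightPerp A T (ModuleCat.of A Y))
    (hX : T (ModuleCat.of A X)) (f : X →ₗ[A] Y) : f = 0 := hY.2 (ModuleCat.of A X) hX f

theorem IsTorsionClass.of_perp (hT : IsTorsionClass A T) [IsNoetherianRing A] {X : Type}
    [AddCommGroup X] [Module A X] [Module.Finite A X]
    (h : ∀ (Y : Type) [AddCommGroup Y] [Module A Y], rightPerp A T (ModuleCat.of A Y) →
      ∀ f : X →ₗ[A] Y, f = 0) : T (ModuleCat.of A X) := by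
  obtain ⟨t, ht, -, h2⟩ := hT.radical X
  have h3 := h _ h2 t.mkQ
  have h4 : t = ⊤ := by rw [← Submodule.ker_mkQ t, h3, LinearMap.ker_zero]
  subst h4
  exact hT.of_surj ht (⊤ : Submodule A X).subtype (fun x => ⟨⟨x, trivial⟩, rfl⟩)

theorem rightPerp_isTorsionFree [IsNoetherianRing A] : IsTorsionFreeClass A (rightPerp A T) where
  fin M h := h.1
  zero M h := by
    refine ⟨⟨⟨∅, ?_⟩⟩, fun N _ f => LinearMap.ext fun x => h _⟩
    refine eq_top_iff.2 fun x _ => ?_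
    rw [h x]; exact zero_mem _
  sub M N hM hN := by
    rintro ⟨i, hi⟩
    refine ⟨hN, fun X hX f => LinearMap.ext fun x => hi ?_⟩
    have := LinearMap.congr_fun (hM.2 X hX (i.comp f)) x
    simpa using this
  ext M hM N h1 h2 := by
    refine ⟨hM, fun X hX f => LinearMap.ext fun x => ?_⟩
    have h3 := h2.2 X hX (N.mkQ.comp f)
    have h4 : ∀ x, f x ∈ N := fun x => by
      have := LinearMap.congr_fun h3 x
      exact (Submodule.Quotient.mk_eq_zero N).1 this
    exact congrArg Subtype.val (LinearMap.congr_fun (h1.2 X hX (f.codRestrict N h4)) x)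

section TF
variable {F : ModuleCat.{0} A → Prop}

theorem IsTorsionFreeClass.of_inj [IsNoetherianRing A] (hF : IsTorsionFreeClass A F) {X Y : Type}
    [AddCommGroup X] [Module A X]
    [AddCommGroup Y] [Module A Y] (hX : F (ModuleCat.of A X)) (f : Y →ₗ[A] X)
    (hf : Function.Injective f) : F (ModuleCat.of A Y) := by
  haveI : Module.Finite A X := hF.fin _ hX
  have h2 : Module.Finite A Y := Module.Finite.of_injective f hf
  exact hF.sub (ModuleCat.of A X) (ModuleCat.of A Y) hX h2 ⟨f, hf⟩

theorem IsTorsionFreeClass.prod [IsNoetherianRing A] (hF : IsTorsionFreeClass A F) {L N : Type}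
    [AddCommGroup L] [Module A L] [AddCommGroup N] [Module A N]
    (hL : F (ModuleCat.of A L)) (hN : F (ModuleCat.of A N)) : F (ModuleCat.of A (L × N)) := by
  haveI : Module.Finite A L := hF.fin _ hL
  haveI : Module.Finite A N := hF.fin _ hN
  refine hF.ext (ModuleCat.of A (L × N)) (inferInstanceAs (Module.Finite A (L × N)))
    (LinearMap.ker (LinearMap.snd A L N)) ?_ ?_
  · refine hF.of_inj hL ((LinearMap.fst A L N).comp (Submodule.subtype _)) ?_
    rintro ⟨⟨a, b⟩, h⟩ ⟨⟨c, d⟩, h'⟩ h2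
    have hb : b = 0 := h
    have hd : d = 0 := h'
    have hac : a = c := h2
    subst hb hd hac
    rfl
  · exact hF.of_inj hN ((LinearMap.snd A L N).quotKerEquivOfSurjective
      LinearMap.snd_surjective).toLinearMap ((LinearMap.snd A L N).quotKerEquivOfSurjective
      LinearMap.snd_surjective).injective

theorem IsTorsionFreeClass.pi [IsNoetherianRing A] (hF : IsTorsionFreeClass A F) {L : Type}
    [AddCommGroup L]
    [Module A L] (hL : F (ModuleCat.of A L)) (n : ℕ) : F (ModuleCat.of A (Fin n → L)) := by
  induction n with
  | zero => exact hF.zero _ fun x => Subsingleton.elim (α := Fin 0 → L) x 0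
  | succ n ih =>
    exact hF.of_inj (hF.prod hL ih)
      (Fin.consLinearEquiv A (fun _ : Fin (n+1) => L)).symm.toLinearMap
      (Fin.consLinearEquiv A (fun _ : Fin (n+1) => L)).symm.injective

end TF

/-- The trace of `C` in `X` is the image of a finite power of `C`. -/
theorem exists_trace [IsNoetherianRing A] (C X : Type) [AddCommGroup C] [Module A C]
    [AddCommGroup X] [Module A X] [Module.Finite A X] :
    ∃ (k : ℕ) (g : (Fin k → C) →ₗ[A] X), ∀ h : C →ₗ[A] X, LinearMap.range h ≤ LinearMap.range g := by
  obtain ⟨R, ⟨k, g, rfl⟩, hmax⟩ := (wellFounded_gt (α := Submodule A X)).has_min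
    {S | ∃ (k : ℕ) (g : (Fin k → C) →ₗ[A] X), S = LinearMap.range g} ⟨_, 0, 0, rfl⟩
  refine ⟨k, g, fun h => ?_⟩
  by_contra hc
  let g' : (Fin (k+1) → C) →ₗ[A] X :=
    (h.coprod g).comp (Fin.consLinearEquiv A (fun _ : Fin (k+1) => C)).symm.toLinearMap
  have hg' : LinearMap.range g' = LinearMap.range h ⊔ LinearMap.range g := by
    rw [LinearMap.range_comp_of_range_eq_top _ (LinearEquiv.range _), LinearMap.range_coprod]
  refine hmax (LinearMap.range g') ⟨k+1, g', rfl⟩ (lt_of_le_of_ne ?_ ?_)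
  · rw [hg']; exact le_sup_right
  · intro h'
    rw [hg'] at h'
    exact hc (h' ▸ le_sup_left)

/-- Dually, the reject. -/
theorem exists_reject [IsArtinianRing A] (C X : Type) [AddCommGroup C] [Module A C]
    [AddCommGroup X] [Module A X] [Module.Finite A X] :
    ∃ (k : ℕ) (g : X →ₗ[A] (Fin k → C)), ∀ h : X →ₗ[A] C, LinearMap.ker g ≤ LinearMap.ker h := by
  obtain ⟨R, ⟨k, g, rfl⟩, hmin⟩ := (wellFounded_lt (α := Submodule A X)).has_min
    {S | ∃ (k : ℕ) (g : X →ₗ[A] (Fin k → C)), S = LinearMap.ker g} ⟨_, 0, 0, rfl⟩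
  refine ⟨k, g, fun h => ?_⟩
  by_contra hc
  let g' : X →ₗ[A] (Fin (k+1) → C) :=
    (Fin.consLinearEquiv A (fun _ : Fin (k+1) => C)).toLinearMap.comp (h.prod g)
  have hg' : LinearMap.ker g' = LinearMap.ker h ⊓ LinearMap.ker g := by
    rw [LinearEquiv.ker_comp, LinearMap.ker_prod]
  refine hmin (LinearMap.ker g') ⟨k+1, g', rfl⟩ (lt_of_le_of_ne ?_ ?_)
  · rw [hg']; exact inf_le_right
  · intro h'
    rw [hg'] at h'
    exact hc (h' ▸ inf_le_left)

end TorsLemmas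

set_option linter.style.haveILetI false
set_option linter.unusedSectionVars false
section Gordan

theorem exists_nat_large {n : ℕ} (a b : Fin n → ℤ) (ha : ∀ i, 0 < a i) :
    ∃ N : ℕ, ∀ i, 0 < (N : ℤ) * a i + b i := by
  refine ⟨1 + ∑ i, (b i).natAbs, fun i => ?_⟩
  have h1 : (b i).natAbs ≤ ∑ i, (b i).natAbs :=
    Finset.single_le_sum (f := fun i => (b i).natAbs) (fun _ _ => Nat.zero_le _) (Finset.mem_univ i)
  have h2 : ((∑ i, (b i).natAbs : ℕ) : ℤ) ≥ |b i| := by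
    rw [Int.abs_eq_natAbs]; exact_mod_cast h1
  have h3 := ha i
  have h4 := neg_abs_le (b i)
  push_cast at h2 ⊢
  nlinarith [abs_nonneg (b i)]

theorem gordan {V : Type*} [AddCommGroup V] (D : AddSubgroup (V →+ ℤ))
    (hD : ∀ v : V, v ≠ 0 → ∃ f ∈ D, f v ≠ 0) (n : ℕ) : ∀ v : Fin n → V,
    (∃ h ∈ D, ∀ i, 0 < h (v i)) ∨ (∃ a : Fin n → ℕ, a ≠ 0 ∧ ∑ i, a i • v i = 0) := by
  induction n with
  | zero => exact fun v => Or.inl ⟨0, D.zero_mem, fun i => i.elim0⟩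
  | succ n ih =>
    intro v
    rcases ih (fun i => v i.succ) with ⟨f, hf, hfp⟩ | ⟨a, ha, has⟩
    swap
    · right
      refine ⟨Fin.cons 0 a, fun h => ha ?_, ?_⟩
      · funext i
        simpa using congrFun h i.succ
      · rw [Fin.sum_univ_succ]; simpa using has
    rcases lt_trichotomy (f (v 0)) 0 with h0 | h0 | h0
    · obtain ⟨q, hq⟩ : ∃ q : ℕ, f (v 0) = -(q : ℤ) := ⟨(f (v 0)).natAbs, by omega⟩
      have hq0 : 0 < q := by omega
      choose c hc using fun i => Int.eq_ofNat_of_zero_le (hfp i).le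
      rcases ih (fun i => q • v i.succ + c i • v 0) with ⟨g, hg, hgp⟩ | ⟨b, hb, hbs⟩
      · left
        obtain ⟨N, hN⟩ := exists_nat_large (fun i => (q : ℤ) * g (v i.succ) + g (v 0) * f (v i.succ))
          (fun i => - f (v i.succ)) (fun i => by
            have := hgp i
            simp only [map_add, map_nsmul, nsmul_eq_mul] at this
            rw [hc i]
            simpa [mul_comm] using this)
        refine ⟨N • (q • g + g (v 0) • f) - f, D.sub_mem (D.nsmul_mem (D.add_mem (D.nsmul_mem hg _)
          (D.zsmul_mem hf _)) _) hf, ?_⟩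
        refine Fin.forall_fin_succ.2 ⟨?_, fun i => ?_⟩
        · have : (N • (q • g + g (v 0) • f) - f) (v 0)
              = N * (q * g (v 0) + g (v 0) * f (v 0)) - f (v 0) := by
            simp; ring
          rw [this, hq]
          have : (0:ℤ) < q := by exact_mod_cast hq0
          linarith
        · have h1 : (N • (q • g + g (v 0) • f) - f) (v i.succ)
              = N * (q * g (v i.succ) + g (v 0) * f (v i.succ)) - f (v i.succ) := by
            simp; ring
          rw [h1]
          have := hN i
          linarith
      · right
        refine ⟨Fin.cons (∑ i, b i * c i) (fun i => b i * q), fun h => hb ?_, ?_⟩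
        · funext i
          have := congrFun h i.succ
          simp only [Fin.cons_succ, Pi.zero_apply, mul_eq_zero] at this
          rcases this with h | h
          · exact h
          · omega
        · rw [Fin.sum_univ_succ]
          simp only [Fin.cons_zero, Fin.cons_succ]
          rw [← hbs, Finset.sum_smul, ← Finset.sum_add_distrib]
          refine Finset.sum_congr rfl fun i _ => ?_
          rw [smul_add, mul_smul, mul_smul, add_comm]
    · by_cases hv : v 0 = 0
      · right
        refine ⟨Pi.single 0 1, by simp, ?_⟩
        rw [Finset.sum_eq_single 0]
        · simp [hv]
        · intro i _ hi
          simp [Pi.single_eq_of_ne hi]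
        · simp
      · left
        obtain ⟨g, hg, hgv⟩ : ∃ g ∈ D, 0 < g (v 0) := by
          obtain ⟨g, hg, hgv⟩ := hD _ hv
          rcases lt_or_gt_of_ne hgv with h | h
          · exact ⟨-g, D.neg_mem hg, by simpa using h⟩
          · exact ⟨g, hg, h⟩
        obtain ⟨N, hN⟩ := exists_nat_large (fun i => f (v i.succ)) (fun i => g (v i.succ)) hfp
        refine ⟨N • f + g, D.add_mem (D.nsmul_mem hf _) hg, ?_⟩
        refine Fin.forall_fin_succ.2 ⟨?_, fun i => ?_⟩
        · simpa [h0] using hgv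
        · simpa using hN i
    · exact Or.inl ⟨f, hf, Fin.forall_fin_succ.2 ⟨h0, hfp⟩⟩

end Gordan

section K0
variable {A : Type} [Ring A] (K : Type) [Field K] [Algebra K A] [FiniteDimensional K A]

theorem IsAdditiveZ.exact {φ : ModuleCat.{0} A → ℤ} (hφ : IsAdditiveZ A φ) {L M N : Type}
    [AddCommGroup L] [Module A L] [AddCommGroup M] [Module A M] [AddCommGroup N] [Module A N]
    [Module.Finite A L] [Module.Finite A M] [Module.Finite A N]
    (f : L →ₗ[A] M) (g : M →ₗ[A] N)
    (hf : Function.Injective f) (hg : Function.Surjective g)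
    (hfg : LinearMap.range f = LinearMap.ker g) :
    φ (ModuleCat.of A M) = φ (ModuleCat.of A L) + φ (ModuleCat.of A N) :=
  hφ (ModuleCat.of A L) (ModuleCat.of A M) (ModuleCat.of A N)
    (inferInstanceAs (Module.Finite A L)) (inferInstanceAs (Module.Finite A M))
    (inferInstanceAs (Module.Finite A N)) f g hf hg hfg

theorem IsAdditiveZ.zero {φ : ModuleCat.{0} A → ℤ} (hφ : IsAdditiveZ A φ) (Z : ModuleCat.{0} A)
    [Module.Finite A Z] (h : ∀ z : Z, z = 0) : φ Z = 0 := by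
  have := hφ.exact (LinearMap.id : Z →ₗ[A] Z) (LinearMap.id : Z →ₗ[A] Z)
    Function.injective_id Function.surjective_id (by
      ext x; rw [h x]; simp)
  have h2 : ModuleCat.of A Z = Z := rfl
  rw [h2] at this
  omega

theorem sameK0_aux (n : ℕ) : ∀ (X Y : ModuleCat.{0} A) [Module.Finite A X] [Module.Finite A Y],
    hd (A := A) K A X ≤ n →
    (∀ P : ModuleCat.{0} A, Module.Finite A P → Module.Projective A P →
      hd (A := A) K P X = hd (A := A) K P Y) → SameK0Class A X Y := by
  haveI := noeth (A := A) K
  induction n with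
  | zero =>
    intro X Y _ _ hX h φ hφ
    have h1 : hd (A := A) K A X = 0 := by omega
    have h2 : hd (A := A) K A Y = 0 := by
      rw [← h1]
      exact (h (ModuleCat.of A A) (inferInstanceAs (Module.Finite A A))
        (inferInstanceAs (Module.Projective A A))).symm
    rw [hd_ring_zero_iff] at h1 h2
    rw [hφ.zero X h1, hφ.zero Y h2]
  | succ n ih =>
    intro X Y _ _ hX h
    by_cases hX0 : ∀ x : X, x = 0
    · have h1 : hd (A := A) K A X = 0 := (hd_ring_zero_iff K).2 hX0
      exact ih X Y (by omega) h
    push Not at hX0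
    obtain ⟨x0, hx0⟩ := hX0
    haveI : Nontrivial X := ⟨⟨x0, 0, hx0⟩⟩
    obtain ⟨L, hL⟩ := IsCoatomic.exists_coatom (Submodule A X)
    haveI hS : IsSimpleModule A (X ⧸ L) := isSimpleModule_iff_isCoatom.2 hL
    haveI : Nontrivial (X ⧸ L) := IsSimpleModule.nontrivial A _
    obtain ⟨P, π, hP1, hP2, hπ, hcov⟩ := exists_cover (A := A) K (X ⧸ L)
    have hPS : hd (A := A) K P (X ⧸ L) ≠ 0 := by
      intro h0
      rw [hd_zero_iff] at h0
      have h1 := h0 π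
      obtain ⟨s, hs⟩ := exists_ne (0 : X ⧸ L)
      obtain ⟨p, hp⟩ := hπ s
      rw [h1] at hp
      exact hs hp.symm
    have hPY : hd (A := A) K P Y ≠ 0 := by
      rw [← h P hP1 hP2, hd_sub_quot K L]
      omega
    obtain ⟨u, hu⟩ : ∃ u : P →ₗ[A] Y, u ≠ 0 := by
      rw [Ne, hd_zero_iff] at hPY
      push Not at hPY
      exact hPY
    have hker : LinearMap.ker u ≤ LinearMap.ker π := by
      by_contra hc
      have h1 : Submodule.map π (LinearMap.ker u) = ⊤ := by
        rcases eq_bot_or_eq_top (Submodule.map π (LinearMap.ker u)) with h1 | h1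
        · exact absurd ((Submodule.map_le_iff_le_comap.1 h1.le).trans_eq rfl) hc
        · exact h1
      exact hu (LinearMap.ker_eq_top.1 (hcov _ h1))
    let q : LinearMap.range u →ₗ[A] (X ⧸ L) :=
      ((LinearMap.ker u).liftQ π hker).comp u.quotKerEquivRange.symm.toLinearMap
    have hq : Function.Surjective q := by
      intro s
      obtain ⟨p, hp⟩ := hπ s
      refine ⟨u.quotKerEquivRange (Submodule.Quotient.mk p), ?_⟩
      change ((LinearMap.ker u).liftQ π hker) (u.quotKerEquivRange.symm (u.quotKerEquivRange _)) = s
      rw [LinearEquiv.symm_apply_apply]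
      exact hp
    -- the comparison
    have key : ∀ ψ : ModuleCat.{0} A → ℤ, IsAdditiveZ A ψ →
        ψ X = ψ (ModuleCat.of A L) + ψ (ModuleCat.of A (X ⧸ L)) ∧
        ψ Y = ψ (ModuleCat.of A (LinearMap.ker q × (Y ⧸ LinearMap.range u)))
          + ψ (ModuleCat.of A (X ⧸ L)) := by
      intro ψ hψ
      refine ⟨hψ.exact L.subtype L.mkQ (Submodule.injective_subtype L) (Submodule.mkQ_surjective L)
        (by simp), ?_⟩
      have h1 := hψ.exact (LinearMap.range u).subtype (LinearMap.range u).mkQ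
        (Submodule.injective_subtype _) (Submodule.mkQ_surjective _) (by simp)
      have h2 := hψ.exact (LinearMap.ker q).subtype q (Submodule.injective_subtype _) hq (by simp)
      have h3 := hψ.exact (LinearMap.inl A (LinearMap.ker q) (Y ⧸ LinearMap.range u))
        (LinearMap.snd A (LinearMap.ker q) (Y ⧸ LinearMap.range u)) LinearMap.inl_injective
        LinearMap.snd_surjective (LinearMap.range_inl _ _ _)
      have h4 : ModuleCat.of A Y = Y := rfl
      rw [h4] at h1
      linarith
    have hdadd : ∀ P : ModuleCat.{0} A, Module.Finite A P → Module.Projective A P →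
        IsAdditiveZ A (fun X => (hd (A := A) K P X : ℤ)) := by
      intro P _ _ L M N _ _ _ f g hf hg hfg
      have h1 := hd_add (P := P) K f g hf hg hfg
      simp only
      exact_mod_cast h1
    have hLdim : hd (A := A) K A L ≤ n := by
      have h1 := hd_sub_quot (P := A) K L
      have h2 : hd (A := A) K A (X ⧸ L) ≠ 0 := by
        intro h0
        rw [hd_ring_zero_iff] at h0
        obtain ⟨s, hs⟩ := exists_ne (0 : X ⧸ L)
        exact hs (h0 s)
      omega
    have hrec := ih (ModuleCat.of A L)
      (ModuleCat.of A (LinearMap.ker q × (Y ⧸ LinearMap.range u))) hLdim (by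
        intro P hP1 hP2
        obtain ⟨h1, h2⟩ := key _ (hdadd P hP1 hP2)
        have h3 := h P hP1 hP2
        have h4 : (hd (A := A) K P X : ℤ) = hd (A := A) K P Y := by exact_mod_cast h3
        simp only at h1 h2
        have h5 := h1.symm.trans (h4.trans h2)
        exact_mod_cast add_right_cancel h5)
    intro φ hφ
    obtain ⟨h1, h2⟩ := key φ hφ
    rw [h1, h2, hrec φ hφ]

/-- Finitely generated projective modules. -/
def QIdx (A : Type) [Ring A] : Type 1 :=
  {P : ModuleCat.{0} A // Module.Finite A P ∧ Module.Projective A P}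

/-- The dimension vector of `X` indexed by all finitely generated projective modules. -/
noncomputable def xv (X : Type) [AddCommGroup X] [Module A X] : QIdx A → ℤ :=
  fun P => (hd (A := A) K P.1 X : ℤ)

theorem xv_add {L M N : Type} [AddCommGroup L] [Module A L]
    [AddCommGroup M] [Module A M] [AddCommGroup N] [Module A N] [Module.Finite A M]
    (f : L →ₗ[A] M) (g : M →ₗ[A] N)
    (hf : Function.Injective f) (hg : Function.Surjective g)
    (hfg : LinearMap.range f = LinearMap.ker g) :
    xv (A := A) K M = xv (A := A) K L + xv (A := A) K N := by
  funext P
  haveI := P.2.1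
  haveI := P.2.2
  have := hd_add (P := P.1) K f g hf hg hfg
  simp only [xv, Pi.add_apply]
  exact_mod_cast this

theorem xv_sub_quot {M : Type} [AddCommGroup M] [Module A M] [Module.Finite A M]
    (L : Submodule A M) :
    xv (A := A) K M = xv (A := A) K L + xv (A := A) K (M ⧸ L) :=
  xv_add K L.subtype L.mkQ (Submodule.injective_subtype L) (Submodule.mkQ_surjective L) (by simp)

theorem xv_zero {M : Type} [AddCommGroup M] [Module A M] (h : ∀ x : M, x = 0) :
    xv (A := A) K M = 0 := by
  haveI : Module.Finite A M := by
    haveI : Subsingleton M := ⟨fun a b => by rw [h a, h b]⟩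
    infer_instance
  funext P
  haveI := P.2.1
  have : hd (A := A) K P.1 M = 0 := (hd_zero_iff K).2 fun u => LinearMap.ext fun x => h _
  simp [xv, this]

theorem xv_iso {M N : Type} [AddCommGroup M] [Module A M] [AddCommGroup N] [Module A N]
    (e : M ≃ₗ[A] N) : xv (A := A) K M = xv (A := A) K N := by
  funext P
  simp only [xv]
  rw [hd_congr_right K e]

theorem quot_finite_aux (n : ℕ) : ∀ (M : Type) [AddCommGroup M] [Module A M] [Module.Finite A M],
    hd (A := A) K A M ≤ n →
    Set.Finite {v | ∃ (X : ModuleCat.{0} A) (f : M →ₗ[A] X), Function.Surjective f ∧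
      v = xv (A := A) K X} := by
  haveI := noeth (A := A) K
  haveI := artin (A := A) K
  induction n with
  | zero =>
    intro M _ _ _ h
    refine (Set.finite_singleton (0 : QIdx A → ℤ)).subset ?_
    rintro v ⟨X, f, hf, rfl⟩
    have h1 : hd (A := A) K A M = 0 := by omega
    rw [hd_ring_zero_iff] at h1
    refine xv_zero K fun x => ?_
    obtain ⟨m, rfl⟩ := hf x
    rw [h1 m, map_zero]
  | succ n ih =>
    intro M _ _ _ h
    by_cases hM0 : ∀ x : M, x = 0
    · have h1 : hd (A := A) K A M = 0 := (hd_ring_zero_iff K).2 hM0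
      exact ih M (by omega)
    push Not at hM0
    obtain ⟨x0, hx0⟩ := hM0
    haveI : Nontrivial M := ⟨⟨x0, 0, hx0⟩⟩
    obtain ⟨S, hS⟩ := IsAtomic.exists_atom (Submodule A M)
    haveI hS' : IsSimpleModule A S := isSimpleModule_iff_isAtom.2 hS
    have hdim : hd (A := A) K A (M ⧸ S) ≤ n := by
      have h1 := hd_sub_quot (P := A) K S
      have h2 : hd (A := A) K A S ≠ 0 := by
        intro h0
        rw [hd_ring_zero_iff] at h0
        haveI : Nontrivial S := IsSimpleModule.nontrivial A _
        obtain ⟨s, hs⟩ := exists_ne (0 : S)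
        exact hs (h0 s)
      omega
    have hfin := ih (M ⧸ S) hdim
    refine (hfin.union (hfin.image fun v => xv (A := A) K S + v)).subset ?_
    rintro v ⟨X, f, hf, rfl⟩
    haveI : Module.Finite A X := Module.Finite.of_surjective f hf
    let g : S →ₗ[A] X := f.comp S.subtype
    have hX := xv_sub_quot (A := A) K (LinearMap.range g)
    have hmem : ∃ (X' : ModuleCat.{0} A) (f : (M ⧸ S) →ₗ[A] X'), Function.Surjective f ∧
      xv (A := A) K (X ⧸ LinearMap.range g) = xv (A := A) K X' := by
      refine ⟨ModuleCat.of A (X ⧸ LinearMap.range g),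
        S.liftQ ((LinearMap.range g).mkQ.comp f) ?_, ?_, rfl⟩
      · intro s hs
        rw [LinearMap.mem_ker, LinearMap.comp_apply, Submodule.mkQ_apply,
          Submodule.Quotient.mk_eq_zero]
        exact ⟨⟨s, hs⟩, rfl⟩
      · intro y
        obtain ⟨x, rfl⟩ := Submodule.mkQ_surjective _ y
        obtain ⟨m, rfl⟩ := hf x
        exact ⟨Submodule.Quotient.mk m, rfl⟩
    rcases eq_bot_or_eq_top (LinearMap.ker g) with hk | hk
    · right
      refine ⟨_, hmem, ?_⟩
      simp only
      rw [hX, xv_iso K (LinearEquiv.ofInjective g (LinearMap.ker_eq_bot.1 hk))]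
    · left
      have : xv (A := A) K (LinearMap.range g) = 0 := by
        refine xv_zero K ?_
        rintro ⟨y, m, rfl⟩
        have : m ∈ LinearMap.ker g := by rw [hk]; trivial
        exact Subtype.ext this
      rw [hX, this, zero_add]
      exact hmem

theorem sub_finite (N : Type) [AddCommGroup N] [Module A N] [Module.Finite A N] :
    Set.Finite {v | ∃ (Y : ModuleCat.{0} A) (f : Y →ₗ[A] N), Function.Injective f ∧
      v = xv (A := A) K Y} := by
  refine ((quot_finite_aux (A := A) K _ N le_rfl).image fun v => xv (A := A) K N - v).subset ?_
  rintro v ⟨Y, f, hf, rfl⟩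
  refine ⟨xv (A := A) K (N ⧸ LinearMap.range f), ⟨ModuleCat.of A (N ⧸ LinearMap.range f),
    (LinearMap.range f).mkQ, Submodule.mkQ_surjective _, rfl⟩, ?_⟩
  have := xv_add (A := A) K f (LinearMap.range f).mkQ hf (Submodule.mkQ_surjective _) (by simp)
  simp only
  rw [this]
  abel

theorem exists_weights (T : ModuleCat.{0} A → Prop) (hT : IsTorsionClass A T)
    (hnd : NumericallyDisjoint A T (rightPerp A T)) (M N : ModuleCat.{0} A) (hM : T M)
    (hN : rightPerp A T N) :
    ∃ P0 P1 : ModuleCat.{0} A, Module.Finite A P0 ∧ Module.Finite A P1 ∧ Module.Projective A P0 ∧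
      Module.Projective A P1 ∧
      (∀ (X : Type) [AddCommGroup X] [Module A X] (f : M →ₗ[A] X), Function.Surjective f →
        (∃ x : X, x ≠ 0) → hd (A := A) K P1 X < hd (A := A) K P0 X) ∧
      (∀ (Y : Type) [AddCommGroup Y] [Module A Y] (f : Y →ₗ[A] N), Function.Injective f →
        (∃ x : Y, x ≠ 0) → hd (A := A) K P0 Y < hd (A := A) K P1 Y) := by
  haveI := noeth (A := A) K
  haveI := artin (A := A) K
  have hF := rightPerp_isTorsionFree (A := A) (T := T)
  haveI : Module.Finite A M := hT.fin M hM
  haveI : Module.Finite A N := hN.1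
  let R : QIdx A := ⟨ModuleCat.of A A, inferInstanceAs (Module.Finite A A),
    inferInstanceAs (Module.Projective A A)⟩
  have hR : ∀ (X : Type) [AddCommGroup X] [Module A X] [Module.Finite A X], (∃ x : X, x ≠ 0) →
      0 < hd (A := A) K A X := by
    intro X _ _ _ ⟨x, hx⟩
    refine Nat.pos_of_ne_zero fun h => hx ((hd_ring_zero_iff K).1 h x)
  let SX : Set (QIdx A → ℤ) := {v | ∃ (X : ModuleCat.{0} A) (f : M →ₗ[A] X),
    Function.Surjective f ∧ (∃ x : X, x ≠ 0) ∧ v = xv (A := A) K X}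
  let SY : Set (QIdx A → ℤ) := {v | ∃ (Y : ModuleCat.{0} A) (f : Y →ₗ[A] N),
    Function.Injective f ∧ (∃ x : Y, x ≠ 0) ∧ v = -xv (A := A) K Y}
  have hSX : SX.Finite := (quot_finite_aux (A := A) K _ M le_rfl).subset
    (fun v ⟨X, f, h1, _, h3⟩ => ⟨X, f, h1, h3⟩)
  have hSY : SY.Finite := ((sub_finite (A := A) K N).image fun v => -v).subset
    (fun v ⟨X, f, h1, _, h3⟩ => ⟨_, ⟨X, f, h1, rfl⟩, h3.symm⟩)
  haveI : Finite (SX ∪ SY : Set (QIdx A → ℤ)) := (hSX.union hSY).to_subtype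
  obtain ⟨n, ⟨e⟩⟩ := Finite.exists_equiv_fin (SX ∪ SY : Set (QIdx A → ℤ))
  let D : AddSubgroup ((QIdx A → ℤ) →+ ℤ) :=
    AddSubgroup.closure (Set.range fun P => Pi.evalAddMonoidHom (fun _ => ℤ) P)
  have hDsep : ∀ v : QIdx A → ℤ, v ≠ 0 → ∃ f ∈ D, f v ≠ 0 := by
    intro v hv
    obtain ⟨P, hP⟩ := Function.ne_iff.1 hv
    exact ⟨Pi.evalAddMonoidHom (fun _ => ℤ) P, AddSubgroup.subset_closure ⟨P, rfl⟩, hP⟩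
  have hDrep : ∀ h ∈ D, ∃ P0 P1 : QIdx A, ∀ (X : Type) [AddCommGroup X] [Module A X]
      [Module.Finite A X],
      h (xv (A := A) K X) = (hd (A := A) K P0.1 X : ℤ) - hd (A := A) K P1.1 X := by
    intro h hh
    let Z : QIdx A := ⟨ModuleCat.of A PUnit, inferInstanceAs (Module.Finite A PUnit),
      inferInstanceAs (Module.Projective A PUnit)⟩
    have hZ : ∀ (X : Type) [AddCommGroup X] [Module A X] [Module.Finite A X],
        hd (A := A) K Z.1 X = 0 := by
      intro X _ _ _
      haveI := Z.2.1
      refine (hd_zero_iff K).2 fun u => LinearMap.ext fun x => ?_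
      have : x = 0 := Subsingleton.elim (α := PUnit) x 0
      rw [this, map_zero, map_zero]
    induction hh using AddSubgroup.closure_induction with
    | mem f hf =>
      obtain ⟨P, rfl⟩ := hf
      refine ⟨P, Z, fun X _ _ _ => ?_⟩
      rw [hZ]
      simp [xv]
    | zero => exact ⟨Z, Z, fun X _ _ _ => by simp⟩
    | add f g _ _ hf hg =>
      obtain ⟨P0, P1, h1⟩ := hf
      obtain ⟨Q0, Q1, h2⟩ := hg
      have := P0.2.1
      have := P0.2.2
      have := P1.2.1
      have := P1.2.2
      have := Q0.2.1
      have := Q0.2.2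
      have := Q1.2.1
      have := Q1.2.2
      refine ⟨⟨ModuleCat.of A (P0.1 × Q0.1), inferInstanceAs (Module.Finite A (P0.1 × Q0.1)),
        inferInstanceAs (Module.Projective A (P0.1 × Q0.1))⟩,
        ⟨ModuleCat.of A (P1.1 × Q1.1), inferInstanceAs (Module.Finite A (P1.1 × Q1.1)),
        inferInstanceAs (Module.Projective A (P1.1 × Q1.1))⟩, fun X _ _ _ => ?_⟩
      have h3 := hd_prod_left (A := A) (P := P0.1) (Q := Q0.1) (X := X) K
      have h4 := hd_prod_left (A := A) (P := P1.1) (Q := Q1.1) (X := X) K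
      rw [AddMonoidHom.add_apply, h1, h2]
      simp only
      rw [h3, h4]
      push_cast
      ring
    | neg f _ hf =>
      obtain ⟨P0, P1, h1⟩ := hf
      refine ⟨P1, P0, fun X _ _ _ => ?_⟩
      rw [AddMonoidHom.neg_apply, h1]
      ring
  rcases gordan D hDsep n (fun i => (e.symm i).1) with ⟨h, hh, hpos⟩ | ⟨a, ha, hrel⟩
  · obtain ⟨P0, P1, hP⟩ := hDrep h hh
    have hpos' : ∀ v ∈ SX ∪ SY, 0 < h v := by
      intro v hv
      have := hpos (e ⟨v, hv⟩)
      simpa using this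
    refine ⟨P0.1, P1.1, P0.2.1, P1.2.1, P0.2.2, P1.2.2, ?_, ?_⟩
    · intro X _ _ f hf hx
      haveI := Module.Finite.of_surjective f hf
      have := hpos' (xv (A := A) K X) (Or.inl ⟨ModuleCat.of A X, f, hf, hx, rfl⟩)
      rw [hP] at this
      omega
    · intro Y _ _ f hf hx
      haveI := Module.Finite.of_injective f hf
      have := hpos' (-xv (A := A) K Y) (Or.inr ⟨ModuleCat.of A Y, f, hf, hx, rfl⟩)
      rw [map_neg, hP] at this
      omega
  · exfalso
    let B : AddSubmonoid ((QIdx A → ℤ) × ℕ) :=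
      { carrier := {w | ∃ X Y : ModuleCat.{0} A, T X ∧ rightPerp A T Y ∧
          w.1 = xv (A := A) K X - xv (A := A) K Y ∧
          w.2 = hd (A := A) K A X + hd (A := A) K A Y}
        zero_mem' := by
          refine ⟨ModuleCat.of A PUnit, ModuleCat.of A PUnit, hT.zero _ fun x => rfl,
            hF.zero _ fun x => rfl, ?_, ?_⟩
          · simp
          · have : hd (A := A) K A PUnit = 0 := (hd_ring_zero_iff K).2 fun x => rfl
            change 0 = hd (A := A) K A PUnit + hd (A := A) K A PUnit
            rw [this]
        add_mem' := by
          rintro w w' ⟨X, Y, hX, hY, h1, h2⟩ ⟨X', Y', hX', hY', h1', h2'⟩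
          have := hT.fin _ hX
          have := hT.fin _ hX'
          have := hF.fin _ hY
          have := hF.fin _ hY'
          refine ⟨ModuleCat.of A (X × X'), ModuleCat.of A (Y × Y'), hT.prod hX hX',
            hF.prod hY hY', ?_, ?_⟩
          · have e1 := xv_add (A := A) K (LinearMap.inl A X X') (LinearMap.snd A X X')
              LinearMap.inl_injective LinearMap.snd_surjective (LinearMap.range_inl _ _ _)
            have e2 := xv_add (A := A) K (LinearMap.inl A Y Y') (LinearMap.snd A Y Y')
              LinearMap.inl_injective LinearMap.snd_surjective (LinearMap.range_inl _ _ _)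
            change w.1 + w'.1 = xv (A := A) K (X × X') - xv (A := A) K (Y × Y')
            rw [h1, h1', e1, e2]
            abel
          · have e1 := hd_add (A := A) (P := A) K (LinearMap.inl A X X') (LinearMap.snd A X X')
              LinearMap.inl_injective LinearMap.snd_surjective (LinearMap.range_inl _ _ _)
            have e2 := hd_add (A := A) (P := A) K (LinearMap.inl A Y Y') (LinearMap.snd A Y Y')
              LinearMap.inl_injective LinearMap.snd_surjective (LinearMap.range_inl _ _ _)
            change w.2 + w'.2 = hd (A := A) K A (X × X') + hd (A := A) K A (Y × Y')
            rw [h2, h2', e1, e2]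
            omega }
    have hZ0 : hd (A := A) K A PUnit = 0 := (hd_ring_zero_iff K).2 fun x => rfl
    have hZv : xv (A := A) K PUnit = 0 := xv_zero K fun x => rfl
    have hv : ∀ v ∈ SX ∪ SY, ∃ d : ℕ, 0 < d ∧ (v, d) ∈ B := by
      rintro v (⟨X, f, hf, hx, rfl⟩ | ⟨Y, f, hf, hy, rfl⟩)
      · haveI := Module.Finite.of_surjective f hf
        refine ⟨hd (A := A) K A X, hR X hx, X, ModuleCat.of A PUnit, hT.of_surj hM f hf,
          hF.zero _ fun x => rfl, ?_, ?_⟩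
        · change _ = _ - xv (A := A) K PUnit
          rw [hZv, sub_zero]
        · change _ = _ + hd (A := A) K A PUnit
          rw [hZ0, add_zero]
      · haveI := Module.Finite.of_injective f hf
        refine ⟨hd (A := A) K A Y, hR Y hy, ModuleCat.of A PUnit, Y, hT.zero _ fun x => rfl,
          hF.of_inj hN f hf, ?_, ?_⟩
        · change _ = xv (A := A) K PUnit - _
          rw [hZv, zero_sub]
        · change _ = hd (A := A) K A PUnit + _
          rw [hZ0, zero_add]
    choose d hd0 hdB using fun i => hv (e.symm i).1 (e.symm i).2
    have hsum : ∑ i, a i • ((e.symm i).1, d i) ∈ B :=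
      B.sum_mem fun i _ => B.nsmul_mem (hdB i) _
    have hpos : 0 < ∑ i, a i * d i := by
      obtain ⟨i, hi⟩ := Function.ne_iff.1 ha
      refine Finset.sum_pos' (fun _ _ => Nat.zero_le _) ⟨i, Finset.mem_univ _, ?_⟩
      exact Nat.mul_pos (Nat.pos_of_ne_zero hi) (hd0 i)
    obtain ⟨X, Y, hX, hY, h1, h2⟩ := hsum
    haveI := hT.fin _ hX
    haveI := hF.fin _ hY
    rw [Prod.fst_sum] at h1
    rw [Prod.snd_sum] at h2
    simp only [Prod.smul_mk, smul_eq_mul] at h1 h2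
    rw [hrel] at h1
    have h1' : xv (A := A) K X = xv (A := A) K Y := (sub_eq_zero.1 h1.symm)
    have h3 : ∀ P : ModuleCat.{0} A, Module.Finite A P → Module.Projective A P →
        hd (A := A) K P X = hd (A := A) K P Y := by
      intro P hP1 hP2
      have := congrFun h1' ⟨P, hP1, hP2⟩
      simp only [xv] at this
      exact_mod_cast this
    have h4 : hd (A := A) K A X = hd (A := A) K A Y := h3 R.1 R.2.1 R.2.2
    have hXn : Nonzero A X := by
      by_contra hc
      simp only [Nonzero, not_exists, not_not] at hc
      have := (hd_ring_zero_iff (A := A) K).2 hc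
      omega
    have hYn : Nonzero A Y := by
      by_contra hc
      simp only [Nonzero, not_exists, not_not] at hc
      have := (hd_ring_zero_iff (A := A) K).2 hc
      omega
    exact hnd ⟨X, Y, hX, hY, hXn, hYn, sameK0_aux K _ X Y le_rfl h3⟩

end K0

set_option linter.style.haveILetI false
set_option linter.unusedSectionVars false
section TwoBil

theorem two_bilinear {K E V W V' W' : Type} [Field K] [AddCommGroup E] [Module K E]
    [AddCommGroup V] [Module K V] [AddCommGroup W] [Module K W]
    [AddCommGroup V'] [Module K V'] [AddCommGroup W'] [Module K W']
    [FiniteDimensional K E] [FiniteDimensional K V] [FiniteDimensional K W]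
    [FiniteDimensional K V'] [FiniteDimensional K W']
    (β : E →ₗ[K] V →ₗ[K] W)
    (hβ : ∀ U : Submodule K V, U ≠ ⊥ →
      Module.finrank K U < Module.finrank K (Submodule.map₂ β ⊤ U))
    (γ : E →ₗ[K] V' →ₗ[K] W')
    (hγ : ∀ U : Submodule K V', U ≠ ⊥ →
      Module.finrank K U < Module.finrank K (Submodule.map₂ γ ⊤ U)) :
    ∃ (n : ℕ) (f : Fin n → Fin n → E), 0 < n ∧
      (∀ v : Fin n → V, (∀ i', ∑ i, β (f i' i) (v i) = 0) → v = 0) ∧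
      (∀ v : Fin n → V', (∀ i, ∑ i', γ (f i' i) (v i') = 0) → v = 0) := by
  classical
  obtain ⟨e, he⟩ : ∃ e, Module.finrank K E = e := ⟨_, rfl⟩
  let bE := Module.finBasisOfFinrankEq K E he
  rcases Nat.eq_zero_or_pos e with he0 | he0
  · have hE : Subsingleton E := Module.finrank_zero_iff.1 (he.trans he0)
    have aux : ∀ {V W : Type} [AddCommGroup V] [Module K V] [AddCommGroup W] [Module K W]
        (β : E →ₗ[K] V →ₗ[K] W)
        (hβ : ∀ U : Submodule K V, U ≠ ⊥ →
          Module.finrank K U < Module.finrank K (Submodule.map₂ β ⊤ U)), Subsingleton V := by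
      intro V W _ _ _ _ β hβ
      by_contra hc
      rw [not_subsingleton_iff_nontrivial] at hc
      have h1 := hβ ⊤ (by simp)
      have h2 : Submodule.map₂ β ⊤ (⊤ : Submodule K V) = ⊥ := by
        rw [eq_bot_iff, Submodule.map₂_le]
        intro m _ n _
        rw [Subsingleton.elim m 0]
        simp
      rw [h2, finrank_bot] at h1
      omega
    haveI := aux β hβ
    haveI := aux γ hγ
    exact ⟨1, fun _ _ => 0, one_pos, fun v _ => funext fun i => Subsingleton.elim _ _,
      fun v _ => funext fun i => Subsingleton.elim _ _⟩
  obtain ⟨d, hd⟩ : ∃ d, Module.finrank K V = d := ⟨_, rfl⟩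
  obtain ⟨d', hd'⟩ : ∃ d, Module.finrank K V' = d := ⟨_, rfl⟩
  obtain ⟨n, r, hn, hk⟩ := exists_large 2 (d + d') ((d * e) ^ 2 + (d' * e) ^ 2 + 1)
  have hn0 : 0 < n := by omega
  have hnn : n ≤ n * n * e := by
    calc n = n * 1 * 1 := by ring
      _ ≤ n * n * e := by gcongr <;> omega
  have h1 := bad_covered β hβ bE n (n * n * e - r) (by rw [hd]; omega)
  have h2 := bad_covered γ hγ bE n (n * n * e - r) (by rw [hd']; omega)
  rw [hd] at h1
  rw [hd'] at h2
  have h2' := h2.reindex (fun x : Fin n × Fin n × Fin e => (x.2.1, x.1, x.2.2))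
    {f : Fin n × Fin n × Fin e → K | ∃ v : Fin n → V', v ≠ 0 ∧
        ∀ i, ∑ i', γ (∑ t, f (i', i, t) • bE t) (v i') = 0} (by
      rintro f ⟨v, hv, hf⟩
      exact ⟨fun x => f (x.2.1, x.1, x.2.2), ⟨v, hv, hf⟩, fun i => rfl⟩)
  obtain ⟨f, hf⟩ := (h1.union h2').exists_not_mem r (by
    simp only [Fintype.card_prod, Fintype.card_fin]
    rw [← mul_assoc]
    omega) (by
    refine lt_of_le_of_lt ?_ hk
    have e1 : n ^ d ≤ n ^ (d + d') := Nat.pow_le_pow_right hn0 (by omega)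
    have e2 : n ^ d' ≤ n ^ (d + d') := Nat.pow_le_pow_right hn0 (by omega)
    omega)
  refine ⟨n, fun i' i => ∑ t, f (i', i, t) • bE t, hn0, fun v hv => ?_, fun v hv => ?_⟩
  · by_contra hc
    exact hf (Or.inl ⟨v, hc, hv⟩)
  · by_contra hc
    exact hf (Or.inr ⟨v, hc, hv⟩)

end TwoBil

section HomInto
variable {A : Type} [Ring A] (K : Type) [Field K] [Algebra K A]

/-- The subspace of maps with values in `Y`. -/
def homInto (P : Type) {X : Type} [AddCommGroup P] [Module A P] [AddCommGroup X] [Module A X]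
    [Module K X] [IsScalarTower K A X] (Y : Submodule A X) : Submodule K (P →ₗ[A] X) where
  carrier := {u | ∀ p, u p ∈ Y}
  add_mem' h h' p := Y.add_mem (h p) (h' p)
  zero_mem' p := Y.zero_mem
  smul_mem' c u h p := by
    change c • u p ∈ Y
    rw [← algebraMap_smul A c (u p)]
    exact Y.smul_mem _ (h p)

theorem finrank_homInto (P : Type) {X : Type} [AddCommGroup P] [Module A P] [AddCommGroup X]
    [Module A X] [Module K X] [IsScalarTower K A X] (Y : Submodule A X) :
    Module.finrank K (homInto K P Y) = hd (A := A) K P Y := by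
  letI := kMod (A := A) K Y
  haveI := kTower (A := A) K Y
  rw [hd_eq]
  have h1 : homInto K P Y = LinearMap.range (postc (A := A) (P := P) K Y.subtype) := by
    ext u
    constructor
    · intro hu
      exact ⟨u.codRestrict Y hu, rfl⟩
    · rintro ⟨v, rfl⟩ p
      exact (v p).2
  rw [h1, LinearMap.finrank_range_of_inj]
  intro u v huv
  ext x
  exact LinearMap.congr_fun huv x

theorem lift_range {P L X : Type} [AddCommGroup P] [Module A P] [AddCommGroup L] [Module A L]
    [AddCommGroup X] [Module A X] [Module.Projective A P] (G : L →ₗ[A] X) (u : P →ₗ[A] X)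
    (h : ∀ p, u p ∈ LinearMap.range G) : ∃ w : P →ₗ[A] L, G.comp w = u := by
  obtain ⟨w, hw⟩ := Module.projective_lifting_property G.rangeRestrict
    (u.codRestrict (LinearMap.range G) h) G.surjective_rangeRestrict
  refine ⟨w, LinearMap.ext fun p => ?_⟩
  exact congrArg Subtype.val (LinearMap.congr_fun hw p)

variable [FiniteDimensional K A]

theorem mem_span_comp {P0 P1 X : Type} [AddCommGroup P0] [Module A P0] [AddCommGroup P1]
    [Module A P1] [AddCommGroup X] [Module A X] [Module K X] [IsScalarTower K A X]
    [Module.Finite A P0] [Module.Finite A X] [Module.Projective A P1]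
    (U : Submodule K (P0 →ₗ[A] X)) (u : P1 →ₗ[A] X)
    (hu : ∀ p, u p ∈ ⨆ v ∈ U, LinearMap.range v) :
    ∃ (k : ℕ) (v : Fin k → (P0 →ₗ[A] X)) (e : Fin k → (P1 →ₗ[A] P0)),
      (∀ i, v i ∈ U) ∧ u = ∑ i, (v i).comp (e i) := by
  letI := kMod (A := A) K P0
  haveI := kTower (A := A) K P0
  haveI := homFinite (A := A) K P0 X
  let b := Module.finBasis K U
  let G : (Fin (Module.finrank K U) → P0) →ₗ[A] X := ∑ i, (b i).1.comp (LinearMap.proj i)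
  have hG : ∀ x, G x = ∑ i, (b i).1 (x i) := fun x => by simp [G, LinearMap.sum_apply]
  have h1 : ⨆ v ∈ U, LinearMap.range v ≤ LinearMap.range G := by
    refine iSup₂_le ?_
    rintro v hv _ ⟨p, rfl⟩
    refine ⟨fun i => b.repr ⟨v, hv⟩ i • p, ?_⟩
    rw [hG]
    have h2 := congrArg Subtype.val (b.sum_repr ⟨v, hv⟩)
    have h3 := LinearMap.congr_fun h2 p
    simp only [Submodule.coe_sum, Submodule.coe_smul, LinearMap.sum_apply, LinearMap.smul_apply]
      at h3
    rw [← h3]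
    refine Finset.sum_congr rfl fun i _ => ?_
    exact LinearMap.map_smul_of_tower _ _ _
  obtain ⟨w, hw⟩ := lift_range G u fun p => h1 (hu p)
  refine ⟨_, fun i => (b i).1, fun i => (LinearMap.proj i).comp w, fun i => (b i).2, ?_⟩
  ext p
  rw [← hw, LinearMap.comp_apply, hG]
  simp [LinearMap.sum_apply]

/-- Composition as a bilinear map. -/
def compBil (P0 P1 X : Type) [AddCommGroup P0] [Module A P0] [AddCommGroup P1]
    [Module A P1] [AddCommGroup X] [Module A X] [Module K X] [IsScalarTower K A X]
    [Module K P0] [IsScalarTower K A P0] :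
    (P1 →ₗ[A] P0) →ₗ[K] (P0 →ₗ[A] X) →ₗ[K] (P1 →ₗ[A] X) :=
  LinearMap.mk₂ K (fun e v => v.comp e) (fun e e' v => by ext; simp)
    (fun c e v => by ext x; simp [v.map_smul_of_tower]) (fun e v v' => by ext; simp)
    (fun c e v => by ext; simp)

theorem exists_presentation (P0 P1 M N : Type) [AddCommGroup P0] [Module A P0] [AddCommGroup P1]
    [Module A P1] [AddCommGroup M] [Module A M] [AddCommGroup N] [Module A N]
    [Module.Finite A P0] [Module.Finite A P1] [Module.Finite A M] [Module.Finite A N]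
    [Module.Projective A P0] [Module.Projective A P1]
    (hM : ∀ (X : Type) [AddCommGroup X] [Module A X] (f : M →ₗ[A] X), Function.Surjective f →
        (∃ x : X, x ≠ 0) → hd (A := A) K P1 X < hd (A := A) K P0 X)
    (hN : ∀ (Y : Type) [AddCommGroup Y] [Module A Y] (f : Y →ₗ[A] N), Function.Injective f →
        (∃ x : Y, x ≠ 0) → hd (A := A) K P0 Y < hd (A := A) K P1 Y) :
    ∃ (n : ℕ) (F : (Fin n → P1) →ₗ[A] (Fin n → P0)), 0 < n ∧
      (∀ v : (Fin n → P0) →ₗ[A] N, v.comp F = 0 → v = 0) ∧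
      (∀ u : (Fin n → P1) →ₗ[A] M, ∃ v : (Fin n → P0) →ₗ[A] M, v.comp F = u) := by
  classical
  letI := kMod (A := A) K P0
  haveI := kTower (A := A) K P0
  letI := kMod (A := A) K M
  haveI := kTower (A := A) K M
  letI := kMod (A := A) K N
  haveI := kTower (A := A) K N
  haveI := homFinite (A := A) K P1 P0
  haveI := homFinite (A := A) K P0 M
  haveI := homFinite (A := A) K P1 M
  haveI := homFinite (A := A) K P0 N
  haveI := homFinite (A := A) K P1 N
  let γ : (P1 →ₗ[A] P0) →ₗ[K] Module.Dual K (P1 →ₗ[A] M) →ₗ[K] Module.Dual K (P0 →ₗ[A] M) :=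
    LinearMap.mk₂ K (fun e ξ => ξ.comp (compBil K P0 P1 M e))
      (fun e e' v => by ext; simp)
      (fun c e v => by ext x; simp) (fun e v v' => by ext; simp)
      (fun c e v => by ext; simp)
  obtain ⟨n, f, hn, h1, h2⟩ := two_bilinear (compBil K P0 P1 N) (by
    intro U hU
    set Y : Submodule A N := ⨆ v ∈ U, LinearMap.range v with hY
    have e1 : U ≤ homInto K P0 Y := by
      intro v hv p
      exact (le_iSup₂_of_le (f := fun (v : P0 →ₗ[A] N) (_ : v ∈ U) => LinearMap.range v)
        v hv le_rfl) ⟨p, rfl⟩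
    have e2 : homInto K P1 Y ≤ Submodule.map₂ (compBil K P0 P1 N) ⊤ U := by
      intro u hu
      obtain ⟨k, v, e, hv, rfl⟩ := mem_span_comp K U u hu
      exact Submodule.sum_mem _ fun i _ => Submodule.apply_mem_map₂ (compBil K P0 P1 N)
        (Submodule.mem_top (x := e i)) (hv i)
    have e3 := Submodule.finrank_mono e1
    have e4 := Submodule.finrank_mono e2
    rw [finrank_homInto] at e3 e4
    have e5 := hN Y Y.subtype (Submodule.injective_subtype Y) (by
      obtain ⟨v, hv, hv0⟩ := (Submodule.ne_bot_iff U).1 hU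
      obtain ⟨p, hp⟩ : ∃ p, v p ≠ 0 := by
        by_contra hc
        push Not at hc
        exact hv0 (LinearMap.ext hc)
      exact ⟨⟨v p, e1 hv p⟩, fun h => hp (congrArg Subtype.val h)⟩)
    omega) γ (by
    intro U hU
    set Θ := Submodule.map₂ γ ⊤ U with hΘ
    have f1 := Subspace.finrank_add_finrank_dualCoannihilator_eq U
    have f2 := Subspace.finrank_add_finrank_dualCoannihilator_eq Θ
    set W' := U.dualCoannihilator with hW'
    set V' := Θ.dualCoannihilator with hV'
    set Y : Submodule A M := ⨆ v ∈ V', LinearMap.range v with hY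
    have e1 : V' ≤ homInto K P0 Y := by
      intro v hv p
      exact (le_iSup₂_of_le (f := fun (v : P0 →ₗ[A] M) (_ : v ∈ V') => LinearMap.range v)
        v hv le_rfl) ⟨p, rfl⟩
    have e2 : homInto K P1 Y ≤ W' := by
      intro u hu
      obtain ⟨k, v, e, hv, rfl⟩ := mem_span_comp K V' u hu
      refine Submodule.sum_mem _ fun i _ => ?_
      rw [hW', Submodule.mem_dualCoannihilator]
      intro ξ hξ
      have := (Submodule.mem_dualCoannihilator _).1 (hv i) (γ (e i) ξ)
        (Submodule.apply_mem_map₂ γ (Submodule.mem_top (x := e i)) hξ)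
      exact this
    have e3 := Submodule.finrank_mono e1
    have e4 := Submodule.finrank_mono e2
    rw [finrank_homInto] at e3 e4
    have g0 := hd_sub_quot (P := P0) K Y
    have g1 := hd_sub_quot (P := P1) K Y
    rw [hd_eq (A := A) K P0 M] at g0
    rw [hd_eq (A := A) K P1 M] at g1
    by_cases hq : ∃ x : M ⧸ Y, x ≠ 0
    · have e5 := hM (M ⧸ Y) Y.mkQ (Submodule.mkQ_surjective Y) hq
      omega
    · exfalso
      push Not at hq
      have : hd (A := A) K P1 (M ⧸ Y) = 0 :=
        (hd_zero_iff K).2 fun u => LinearMap.ext fun x => hq _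
      have h3 : Module.finrank K U = 0 := by omega
      exact hU (Submodule.finrank_eq_zero.1 h3))
  let F : (Fin n → P1) →ₗ[A] (Fin n → P0) :=
    LinearMap.pi fun i => ∑ i', (f i' i).comp (LinearMap.proj i')
  have hF : ∀ x i, F x i = ∑ i', f i' i (x i') := fun x i => by
    simp [F, LinearMap.sum_apply]
  refine ⟨n, F, hn, fun v hv => ?_, fun u => ?_⟩
  · have h3 := h1 (fun i => v.comp (LinearMap.single A (fun _ => P0) i)) (fun i' => by
      ext p
      have h4 := LinearMap.congr_fun hv (Pi.single i' p)
      have h5 : F (Pi.single i' p) = ∑ i, Pi.single i (f i' i p) := by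
        funext j
        rw [hF, Finset.sum_apply, Finset.sum_eq_single i', Finset.sum_eq_single j]
        · simp
        · intro b _ hb
          exact Pi.single_eq_of_ne hb.symm _
        · simp
        · intro b _ hb
          rw [Pi.single_eq_of_ne hb, map_zero]
        · simp
      rw [LinearMap.comp_apply, h5, map_sum] at h4
      simpa [compBil, LinearMap.sum_apply] using h4)
    refine LinearMap.pi_ext fun i x => ?_
    exact LinearMap.congr_fun (congrFun h3 i) x
  · haveI := homFinite (A := A) K (Fin n → P1) M
    have h3 : LinearMap.range (prec (A := A) (X := M) K F) = ⊤ := by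
      by_contra hc
      obtain ⟨ξ, hξ, hξ0⟩ := Submodule.exists_le_ker_of_lt_top _ (lt_top_iff_ne_top.2 hc)
      have h4 := h2 (fun i' => ξ.comp (prec (A := A) (X := M) K (LinearMap.proj i'))) (fun i => by
        refine LinearMap.ext fun v => ?_
        have h5 : prec (A := A) K F (v.comp (LinearMap.proj i)) ∈ LinearMap.ker ξ :=
          hξ0 ⟨_, rfl⟩
        have h6 : prec (A := A) K F (v.comp (LinearMap.proj i)) =
            ∑ i', (v.comp (f i' i)).comp (LinearMap.proj i') := by
          refine LinearMap.ext fun x => ?_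
          change v (F x i) = _
          rw [hF, map_sum]
          simp [LinearMap.sum_apply]
        rw [LinearMap.mem_ker, h6, map_sum] at h5
        rw [LinearMap.sum_apply]
        exact h5)
      apply hξ
      refine LinearMap.ext fun u => ?_
      have h7 : u = ∑ i', (u.comp (LinearMap.single A (fun _ => P1) i')).comp
          (LinearMap.proj i') := by
        refine LinearMap.pi_ext fun i x => ?_
        rw [LinearMap.sum_apply, Finset.sum_eq_single i]
        · simp
        · intro b _ hb
          simp [Pi.single_eq_of_ne hb]
        · simp
      rw [h7, map_sum]
      refine Finset.sum_eq_zero fun i' _ => ?_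
      exact LinearMap.congr_fun (congrFun h4 i') (u.comp (LinearMap.single A (fun _ => P1) i'))
    obtain ⟨v, hv⟩ := LinearMap.range_eq_top.1 h3 u
    exact ⟨v, hv⟩

end HomInto

set_option linter.style.haveILetI false
set_option linter.unusedSectionVars false
section Forward
variable {A : Type} [Ring A]

theorem descend {P Z Y : Type} [AddCommGroup P] [Module A P] [AddCommGroup Z] [Module A Z]
    [AddCommGroup Y] [Module A Y] (π : P →ₗ[A] Z) (hπ : Function.Surjective π) (u : P →ₗ[A] Y)
    (h : ∀ x, π x = 0 → u x = 0) : ∃ v : Z →ₗ[A] Y, v.comp π = u := by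
  refine ⟨((LinearMap.ker π).liftQ u h).comp (π.quotKerEquivOfSurjective hπ).symm.toLinearMap,
    LinearMap.ext fun x => ?_⟩
  have : (π.quotKerEquivOfSurjective hπ).symm (π x) = Submodule.Quotient.mk x := by
    rw [LinearEquiv.symm_apply_eq]; rfl
  rw [LinearMap.comp_apply, LinearMap.comp_apply, LinearEquiv.coe_coe, this]
  rfl

theorem finite_of_zero {M : Type} [AddCommGroup M] [Module A M] (h : ∀ x : M, x = 0) :
    Module.Finite A M := by
  haveI : Subsingleton M := ⟨fun a b => by rw [h a, h b]⟩
  infer_instance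

theorem surjClass {L0 L1 : Type} [AddCommGroup L0] [Module A L0] [AddCommGroup L1] [Module A L1]
    [Module.Projective A L0] [Module.Projective A L1] (F : L1 →ₗ[A] L0) :
    IsTorsionClass A (fun X => Module.Finite A X ∧
      ∀ u : L1 →ₗ[A] X, ∃ v : L0 →ₗ[A] X, v.comp F = u) where
  fin M h := h.1
  zero M h := ⟨finite_of_zero h, fun u => ⟨0, LinearMap.ext fun x => by rw [h (u x)]; rfl⟩⟩
  quot M N h hN := by
    rintro ⟨g, hg⟩
    refine ⟨hN, fun u => ?_⟩
    obtain ⟨u', rfl⟩ := Module.projective_lifting_property g u hg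
    obtain ⟨v, rfl⟩ := h.2 u'
    exact ⟨g.comp v, rfl⟩
  ext M hM N h1 h2 := by
    refine ⟨hM, fun u => ?_⟩
    obtain ⟨v', hv'⟩ := h2.2 (N.mkQ.comp u)
    obtain ⟨v, hv⟩ := Module.projective_lifting_property N.mkQ v' N.mkQ_surjective
    have h3 : ∀ x, (u - v.comp F) x ∈ N := by
      intro x
      rw [← Submodule.Quotient.mk_eq_zero, LinearMap.sub_apply, Submodule.Quotient.mk_sub,
        sub_eq_zero]
      have := LinearMap.congr_fun hv' x
      rw [← hv] at this
      exact this.symm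
    obtain ⟨w, hw⟩ := h1.2 ((u - v.comp F).codRestrict N h3)
    refine ⟨N.subtype.comp w + v, LinearMap.ext fun x => ?_⟩
    have h4 : ((w (F x) : N) : M) = (u - v.comp F) x :=
      congrArg Subtype.val (LinearMap.congr_fun hw x)
    change ((w (F x) : N) : M) + v (F x) = u x
    rw [h4]
    simp

theorem injClass {L0 L1 : Type} [AddCommGroup L0] [Module A L0] [AddCommGroup L1] [Module A L1]
    (F : L1 →ₗ[A] L0) :
    IsTorsionFreeClass A (fun X => Module.Finite A X ∧
      ∀ v : L0 →ₗ[A] X, v.comp F = 0 → v = 0) where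
  fin M h := h.1
  zero M h := ⟨finite_of_zero h, fun v _ => LinearMap.ext fun x => h _⟩
  sub M N h hN := by
    rintro ⟨g, hg⟩
    refine ⟨hN, fun v hv => LinearMap.ext fun x => hg ?_⟩
    have h1 := h.2 (g.comp v) (by rw [LinearMap.comp_assoc, hv, LinearMap.comp_zero])
    have := LinearMap.congr_fun h1 x
    simpa using this
  ext M hM N h1 h2 := by
    refine ⟨hM, fun v hv => ?_⟩
    have h3 := h2.2 (N.mkQ.comp v) (by rw [LinearMap.comp_assoc, hv, LinearMap.comp_zero])
    have h4 : ∀ x, v x ∈ N := fun x =>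
      (Submodule.Quotient.mk_eq_zero N).1 (LinearMap.congr_fun h3 x)
    have h5 := h1.2 (v.codRestrict N h4) (LinearMap.ext fun x =>
      Subtype.ext (LinearMap.congr_fun hv x))
    exact LinearMap.ext fun x => congrArg Subtype.val (LinearMap.congr_fun h5 x)

theorem homZeroClass (X : Type) [AddCommGroup X] [Module A X] :
    IsTorsionClass A (fun Z => Module.Finite A Z ∧ ∀ h : Z →ₗ[A] X, h = 0) where
  fin M h := h.1
  zero M h := ⟨finite_of_zero h, fun u => LinearMap.ext fun x => by rw [h x]; simp⟩
  quot M N h hN := by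
    rintro ⟨g, hg⟩
    refine ⟨hN, fun u => LinearMap.ext fun x => ?_⟩
    obtain ⟨y, rfl⟩ := hg x
    exact LinearMap.congr_fun (h.2 (u.comp g)) y
  ext M hM N h1 h2 := by
    refine ⟨hM, fun u => ?_⟩
    have h3 := h1.2 (u.comp N.subtype)
    obtain ⟨v, hv⟩ := descend N.mkQ N.mkQ_surjective u (fun x hx => by
      have hx' : x ∈ N := by simpa using hx
      exact LinearMap.congr_fun h3 ⟨x, hx'⟩)
    have h4 : v = 0 := h2.2 v
    rw [← hv, h4, LinearMap.zero_comp]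

theorem hd_pi_left (K : Type) [Field K] [Algebra K A] [FiniteDimensional K A]
    {P X : Type} [AddCommGroup P] [Module A P]
    [AddCommGroup X] [Module A X] [Module.Finite A P] [Module.Finite A X] (n : ℕ) :
    hd (A := A) K (Fin n → P) X = n * hd (A := A) K P X := by
  induction n with
  | zero =>
    rw [zero_mul, hd_zero_iff]
    intro u
    refine LinearMap.ext fun x => ?_
    rw [Subsingleton.elim x 0, map_zero, map_zero]
  | succ n ih =>
    rw [← hd_congr_left K (Fin.consLinearEquiv A (fun _ : Fin (n+1) => P))]
    have := hd_prod_left (A := A) (P := P) (Q := Fin n → P) (X := X) K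
    rw [ih] at this
    rw [Nat.succ_mul, add_comm, ← this]

theorem exists_kernel (K : Type) [Field K] [Algebra K A] [FiniteDimensional K A]
    {P Q X : Type} [AddCommGroup P] [Module A P] [AddCommGroup Q] [Module A Q]
    [AddCommGroup X] [Module A X] [Module.Finite A P] [Module.Finite A Q] [Module.Finite A X]
    (F : P →ₗ[A] Q) (h : hd (A := A) K P X < hd (A := A) K Q X) :
    ∃ v : Q →ₗ[A] X, v ≠ 0 ∧ v.comp F = 0 := by
  by_contra hc
  push Not at hc
  letI := kMod (A := A) K X
  haveI := kTower (A := A) K X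
  haveI := homFinite (A := A) K P X
  haveI := homFinite (A := A) K Q X
  have h1 : Function.Injective (prec (A := A) (X := X) K F) := by
    rw [← LinearMap.ker_eq_bot, LinearMap.ker_eq_bot']
    intro v hv
    by_contra h0
    exact hc v h0 hv
  have h2 := LinearMap.finrank_le_finrank_of_injective h1
  rw [← hd_eq, ← hd_eq] at h2
  exact absurd h (not_lt.2 h2)

theorem projective_pi (P : Type) [AddCommGroup P] [Module A P] [Module.Projective A P] (n : ℕ) :
    Module.Projective A (Fin n → P) := by
  induction n with
  | zero => infer_instance
  | succ n ih =>
    exact Module.Projective.of_equiv (Fin.consLinearEquiv A (fun _ : Fin (n+1) => P))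

theorem ff_of_fac (K : Type) [Field K] [Algebra K A] [FiniteDimensional K A]
    {T : ModuleCat.{0} A → Prop} (hT : IsTorsionClass A T) (C : Type)
    [AddCommGroup C] [Module A C] (hC : T (ModuleCat.of A C))
    (hfac : ∀ X : ModuleCat.{0} A, T X → ∃ (k : ℕ) (g : (Fin k → C) →ₗ[A] X),
      Function.Surjective g) : FunctoriallyFinite A T := by
  haveI := noeth (A := A) K
  haveI := hT.fin' hC
  constructor
  · intro Z hZ
    obtain ⟨m, π, hπ⟩ := Module.Finite.exists_fin' A Z
    letI := kMod (A := A) K C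
    haveI := kTower (A := A) K C
    haveI := homFinite (A := A) K (Fin m → A) C
    let b := Module.finBasis K ((Fin m → A) →ₗ[A] C)
    let k := Module.finrank K ((Fin m → A) →ₗ[A] C)
    let a : (Fin m → A) →ₗ[A] (Fin k → C) := LinearMap.pi fun i => b i
    have ha : ∀ s : (Fin m → A) →ₗ[A] C, ∃ t : (Fin k → C) →ₗ[A] C, t.comp a = s := by
      intro s
      refine ⟨∑ i, b.repr s i • LinearMap.proj i, LinearMap.ext fun x => ?_⟩
      have := LinearMap.congr_fun (b.sum_repr s) x
      rw [← this]
      simp only [LinearMap.comp_apply, LinearMap.sum_apply, LinearMap.smul_apply]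
      rfl
    have ha' : ∀ (l : ℕ) (s : (Fin m → A) →ₗ[A] (Fin l → C)),
        ∃ t : (Fin k → C) →ₗ[A] (Fin l → C), t.comp a = s := by
      intro l s
      choose t ht using fun i => ha ((LinearMap.proj i).comp s)
      refine ⟨LinearMap.pi t, LinearMap.ext fun x => funext fun i => ?_⟩
      exact LinearMap.congr_fun (ht i) x
    let L : Submodule A (Fin k → C) := Submodule.map a (LinearMap.ker π)
    obtain ⟨f, hf⟩ := descend π hπ (L.mkQ.comp a) (fun x hx => by
      rw [LinearMap.comp_apply, Submodule.mkQ_apply, Submodule.Quotient.mk_eq_zero]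
      exact ⟨x, hx, rfl⟩)
    refine ⟨ModuleCat.of A ((Fin k → C) ⧸ L), f, hT.of_surj (hT.pi hC k) L.mkQ L.mkQ_surjective, ?_⟩
    intro Y hY g
    obtain ⟨l, q, hq⟩ := hfac Y hY
    obtain ⟨s, hs⟩ := Module.projective_lifting_property q (g.comp π) hq
    obtain ⟨t, ht⟩ := ha' l s
    have hqt : ∀ x, q (t (a x)) = g (π x) := by
      intro x
      have h1 := LinearMap.congr_fun ht x
      have h2 := LinearMap.congr_fun hs x
      simp only [LinearMap.comp_apply] at h1 h2
      rw [h1, h2]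
    obtain ⟨h, hh⟩ := descend L.mkQ L.mkQ_surjective (q.comp t) (fun x hx => by
      have hx' : x ∈ L := by simpa using hx
      obtain ⟨y, hy, rfl⟩ := hx'
      rw [LinearMap.comp_apply, hqt, LinearMap.mem_ker.1 hy, map_zero])
    refine ⟨h, LinearMap.ext fun z => ?_⟩
    obtain ⟨x, rfl⟩ := hπ z
    have h1 := LinearMap.congr_fun hf x
    have h2 := LinearMap.congr_fun hh (a x)
    simp only [LinearMap.comp_apply] at h1 h2 ⊢
    rw [hqt] at h2
    exact (congrArg h h1).trans h2
  · intro Z hZ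
    obtain ⟨t, ht, h1, -⟩ := hT.radical Z
    refine ⟨ModuleCat.of A t, t.subtype, ht, fun Y hY g => ?_⟩
    have h2 : ∀ y, g y ∈ t := fun y => h1 Y hY g ⟨y, rfl⟩
    exact ⟨g.codRestrict t h2, LinearMap.ext fun x => rfl⟩

theorem forward (K : Type) [Field K] [Algebra K A] [FiniteDimensional K A]
    {T : ModuleCat.{0} A → Prop} (hT : IsTorsionClass A T) (hc : IsBicompactTors A T)
    (hnd : NumericallyDisjoint A T (rightPerp A T)) : FunctoriallyFinite A T := by
  haveI := noeth (A := A) K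
  haveI := artin (A := A) K
  obtain ⟨⟨M, hMf, hTM⟩, ⟨N, hNf, hFN⟩⟩ := hc
  have hM : T M := by
    rw [hTM]
    exact fun T' _ h => h M rfl
  have hN : rightPerp A T N := by
    rw [hFN]
    exact fun T' _ h => h N rfl
  have hTmin : ∀ T' : ModuleCat.{0} A → Prop, IsTorsionClass A T' → T' M → ∀ X, T X → T' X := by
    intro T' hT' hM' X hX
    rw [hTM] at hX
    exact hX T' hT' (fun Y hY => hY ▸ hM')
  have hFmin : ∀ F' : ModuleCat.{0} A → Prop, IsTorsionFreeClass A F' → F' N →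
      ∀ X, rightPerp A T X → F' X := by
    intro T' hT' hM' X hX
    rw [hFN] at hX
    exact hX T' hT' (fun Y hY => hY ▸ hM')
  obtain ⟨P0, P1, _, _, _, _, hw0, hw1⟩ := exists_weights K T hT hnd M N hM hN
  obtain ⟨n, F, hn, hinj, hsurj⟩ := exists_presentation K P0 P1 M N hw0 hw1
  haveI := projective_pi (A := A) P0 n
  haveI := projective_pi (A := A) P1 n
  have hs : ∀ (X : Type) [AddCommGroup X] [Module A X], T (ModuleCat.of A X) →
      ∀ u : (Fin n → P1) →ₗ[A] X, ∃ v : (Fin n → P0) →ₗ[A] X, v.comp F = u :=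
    fun X _ _ hX => (hTmin _ (surjClass F) ⟨hMf, hsurj⟩ _ hX).2
  have hi : ∀ (X : Type) [AddCommGroup X] [Module A X], rightPerp A T (ModuleCat.of A X) →
      ∀ v : (Fin n → P0) →ₗ[A] X, v.comp F = 0 → v = 0 :=
    fun X _ _ hX => (hFmin _ (injClass F) ⟨hNf, hinj⟩ _ hX).2
  let C := (Fin n → P0) ⧸ LinearMap.range F
  have hC : T (ModuleCat.of A C) := by
    refine hT.of_perp ?_
    intro Y _ _ hY f
    have h1 := hi Y hY (f.comp (LinearMap.range F).mkQ) (by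
      rw [LinearMap.comp_assoc, LinearMap.range_mkQ_comp, LinearMap.comp_zero])
    refine LinearMap.ext fun x => ?_
    obtain ⟨y, rfl⟩ := Submodule.mkQ_surjective _ x
    exact LinearMap.congr_fun h1 y
  refine ff_of_fac K hT C hC ?_
  intro X hX
  haveI := hT.fin X hX
  obtain ⟨k, g, hg⟩ := exists_trace (A := A) C X
  refine ⟨k, g, ?_⟩
  rw [← LinearMap.range_eq_top]
  set R := LinearMap.range g with hR
  have hRT : T (ModuleCat.of A R) := hT.of_range (hT.pi hC k) g
  by_contra hne
  have hXR : T (ModuleCat.of A (X ⧸ R)) := hT.of_surj hX R.mkQ R.mkQ_surjective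
  obtain ⟨m, hm⟩ : ∃ m : M →ₗ[A] (X ⧸ R), m ≠ 0 := by
    by_contra hc
    push Not at hc
    have h1 := (hTmin _ (homZeroClass (X ⧸ R)) ⟨hMf, hc⟩ _ hXR).2 LinearMap.id
    apply hne
    rw [← Submodule.ker_mkQ R, eq_top_iff]
    intro x _
    exact LinearMap.congr_fun h1 (R.mkQ x)
  have hlt := hw0 (LinearMap.range m) m.rangeRestrict m.surjective_rangeRestrict (by
    by_contra hc
    push Not at hc
    exact hm (LinearMap.ext fun x => congrArg Subtype.val (hc ⟨m x, x, rfl⟩)))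
  obtain ⟨v, hv0, hvF⟩ : ∃ v : (Fin n → P0) →ₗ[A] LinearMap.range m, v ≠ 0 ∧ v.comp F = 0 := by
    refine exists_kernel K F ?_
    rw [hd_pi_left, hd_pi_left]
    exact Nat.mul_lt_mul_of_pos_left hlt hn
  obtain ⟨w, hw⟩ := Module.projective_lifting_property R.mkQ
    ((LinearMap.range m).subtype.comp v) R.mkQ_surjective
  have hw' : ∀ x, R.mkQ (w x) = (v x : X ⧸ R) := fun x => LinearMap.congr_fun hw x
  have hwF : ∀ x, (w.comp F) x ∈ R := by
    intro x
    rw [← Submodule.Quotient.mk_eq_zero]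
    refine (hw' (F x)).trans ?_
    have := LinearMap.congr_fun hvF x
    exact congrArg Subtype.val this
  obtain ⟨r, hr⟩ := hs R hRT ((w.comp F).codRestrict R hwF)
  have hr' : ∀ x, ((r (F x) : R) : X) = w (F x) :=
    fun x => congrArg Subtype.val (LinearMap.congr_fun hr x)
  obtain ⟨h, hh⟩ := descend (LinearMap.range F).mkQ (Submodule.mkQ_surjective _)
    (w - R.subtype.comp r) (fun x hx => by
      have hx' : x ∈ LinearMap.range F := by simpa using hx
      obtain ⟨y, rfl⟩ := hx'
      rw [LinearMap.sub_apply, sub_eq_zero]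
      exact (hr' y).symm)
  apply hv0
  refine LinearMap.ext fun x => Subtype.ext ?_
  rw [← hw' x]
  have h1 : h ((LinearMap.range F).mkQ x) ∈ R := hg h ⟨_, rfl⟩
  have h2 : h ((LinearMap.range F).mkQ x) = w x - r x := LinearMap.congr_fun hh x
  rw [h2] at h1
  have h3 : w x ∈ R := by
    have := R.add_mem h1 (r x).2
    rwa [sub_add_cancel] at this
  exact (Submodule.Quotient.mk_eq_zero R).2 h3

end Forward

set_option linter.style.haveILetI false
set_option linter.unusedSectionVars false
section Cogen
variable {A : Type} [Ring A] (K : Type) [Field K] [Algebra K A]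

theorem dual_basis (P : Type) [AddCommGroup P] [Module A P] [Module.Finite A P]
    [Module.Projective A P] :
    ∃ (n : ℕ) (x : Fin n → P) (g : Fin n → (P →ₗ[A] A)), ∀ p, p = ∑ i, g i p • x i := by
  obtain ⟨n, π, hπ⟩ := Module.Finite.exists_fin' A P
  obtain ⟨s, hs⟩ := Module.projective_lifting_property π LinearMap.id hπ
  refine ⟨n, fun i => π (Pi.single i 1), fun i => (LinearMap.proj i).comp s, fun p => ?_⟩
  have h1 : π (s p) = p := LinearMap.congr_fun hs p
  conv_lhs => rw [← h1, pi_eq_sum_univ' (s p)]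
  rw [map_sum]
  refine Finset.sum_congr rfl fun i _ => ?_
  rw [map_smul]
  simp only [LinearMap.comp_apply, LinearMap.proj_apply]

/-- The `K`-dual of `Hom_A(P, A)`. -/
def DD (A : Type) [Ring A] (K : Type) [Field K] [Algebra K A] (P : Type) [AddCommGroup P]
    [Module A P] : Type := Module.Dual K (P →ₗ[A] A)

variable (P : Type) [AddCommGroup P] [Module A P]

instance : AddCommGroup (DD A K P) := inferInstanceAs (AddCommGroup (Module.Dual K (P →ₗ[A] A)))

instance : Module K (DD A K P) := inferInstanceAs (Module K (Module.Dual K (P →ₗ[A] A)))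

/-- Evaluation. -/
def DD.ev {P : Type} [AddCommGroup P] [Module A P] (l : DD A K P) :
    Module.Dual K (P →ₗ[A] A) := l

/-- Right multiplication on `Hom_A(P, Y)`. -/
def rm {P : Type} [AddCommGroup P] [Module A P] {Y : Type} [AddCommGroup Y] [Module A Y]
    (g : P →ₗ[A] A) (y : Y) : P →ₗ[A] Y := (LinearMap.toSpanSingleton A Y y).comp g

theorem rm_apply {P : Type} [AddCommGroup P] [Module A P] {Y : Type} [AddCommGroup Y] [Module A Y]
    (g : P →ₗ[A] A) (y : Y) (p : P) : rm g y p = g p • y := rfl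

instance : Module A (DD A K P) where
  smul a l := (DD.ev K l).comp (postc K (LinearMap.toSpanSingleton A A a))
  one_smul l := by
    change (DD.ev K l).comp (postc K (LinearMap.toSpanSingleton A A 1)) = l
    refine LinearMap.ext fun g => congrArg (DD.ev K l) ?_
    ext x
    simp [postc]
  mul_smul a b l := by
    refine LinearMap.ext fun g => congrArg (DD.ev K l) ?_
    ext x
    simp [postc, mul_assoc]
  smul_zero a := LinearMap.ext fun g => rfl
  smul_add a l l' := LinearMap.ext fun g => rfl
  add_smul a b l := by
    refine LinearMap.ext fun g => ?_
    refine Eq.trans (congrArg (DD.ev K l) ?_) (map_add (DD.ev K l) _ _)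
    ext x
    simp [postc, mul_add]
  zero_smul l := by
    refine LinearMap.ext fun g => ?_
    refine Eq.trans (congrArg (DD.ev K l) ?_) (map_zero (DD.ev K l))
    ext x
    simp [postc]

theorem DD.smul_ev (a : A) (l : DD A K P) (g : P →ₗ[A] A) :
    DD.ev K (a • l) g = DD.ev K l (rm g a) := rfl

instance : IsScalarTower K A (DD A K P) where
  smul_assoc k a l := by
    refine LinearMap.ext fun g => ?_
    refine Eq.trans (congrArg (DD.ev K l) ?_) (map_smul (DD.ev K l) k (rm g a))
    ext x
    simp [rm, postc]

variable [FiniteDimensional K A]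

theorem DD.finite [Module.Finite A P] : Module.Finite A (DD A K P) := by
  haveI := homFinite (A := A) K P A
  haveI : Module.Finite K (DD A K P) :=
    inferInstanceAs (Module.Finite K (Module.Dual K (P →ₗ[A] A)))
  exact Module.Finite.of_restrictScalars_finite K A _

variable {P}

theorem rm_sum {n : ℕ} {x : Fin n → P} {g : Fin n → (P →ₗ[A] A)} (h : ∀ p, p = ∑ i, g i p • x i)
    {Y : Type} [AddCommGroup Y] [Module A Y] (u : P →ₗ[A] Y) :
    u = ∑ i, rm (g i) (u (x i)) := by
  ext p
  conv_lhs => rw [h p]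
  simp [rm_apply, LinearMap.sum_apply]

/-- The functional on `Hom_A(P, Y)` belonging to a map `Y → DD`. -/
theorem DD.toFunctional [Module.Finite A P] [Module.Projective A P]
    {Y : Type} [AddCommGroup Y] [Module A Y]
    [Module K Y] [IsScalarTower K A Y] (h : Y →ₗ[A] DD A K P) :
    ∃ μ : (P →ₗ[A] Y) →ₗ[K] K, ∀ g y, μ (rm g y) = DD.ev K (h y) g := by
  obtain ⟨n, x, g, hx⟩ := dual_basis (A := A) P
  have hk : ∀ (k : K) (y : Y), h (k • y) = k • h y := fun k y => h.map_smul_of_tower k y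
  refine ⟨{ toFun := fun u => ∑ i, DD.ev K (h (u (x i))) (g i)
            map_add' := ?_, map_smul' := ?_ }, fun g' y => ?_⟩
  · intro u v
    rw [← Finset.sum_add_distrib]
    refine Finset.sum_congr rfl fun i _ => ?_
    rw [LinearMap.add_apply, map_add]
    rfl
  · intro k u
    rw [RingHom.id_apply, Finset.smul_sum]
    refine Finset.sum_congr rfl fun i _ => ?_
    rw [LinearMap.smul_apply, hk]
    rfl
  · change ∑ i, DD.ev K (h (rm g' y (x i))) (g i) = _
    conv_rhs => rw [rm_sum hx g', map_sum]
    refine Finset.sum_congr rfl fun i _ => ?_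
    rw [rm_apply, map_smul, DD.smul_ev]

/-- The map `Y → DD` belonging to a functional on `Hom_A(P, Y)`. -/
theorem DD.ofFunctional {Y : Type} [AddCommGroup Y] [Module A Y]
    [Module K Y] [IsScalarTower K A Y] (μ : (P →ₗ[A] Y) →ₗ[K] K) :
    ∃ h : Y →ₗ[A] DD A K P, ∀ g y, DD.ev K (h y) g = μ (rm g y) := by
  refine ⟨{ toFun := fun y => (μ.comp (postc K (LinearMap.toSpanSingleton A Y y)) :
      (P →ₗ[A] A) →ₗ[K] K), map_add' := ?_, map_smul' := ?_ }, fun g y => rfl⟩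
  · intro y z
    refine LinearMap.ext fun g => ?_
    refine Eq.trans (congrArg μ ?_) (map_add μ (rm g y) (rm g z))
    ext p
    simp [postc, rm_apply]
  · intro a y
    refine LinearMap.ext fun g => congrArg μ ?_
    ext p
    simp [postc, mul_smul]

/-- The cogenerator. -/
def cog {P0 : Type} [AddCommGroup P0] [Module A P0] (f : P →ₗ[A] P0) :
    Submodule A (DD A K P) where
  carrier := {l | ∀ g : P0 →ₗ[A] A, DD.ev K l (g.comp f) = 0}
  add_mem' h h' g := (congrArg₂ (· + ·) (h g) (h' g)).trans (add_zero _)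
  zero_mem' g := rfl
  smul_mem' a l h g := h (rm g a)

theorem exists_cogen (K : Type) [Field K] [Algebra K A] [FiniteDimensional K A]
    {T : ModuleCat.{0} A → Prop} {P1 P0 : Type} [AddCommGroup P1]
    [Module A P1] [AddCommGroup P0] [Module A P0] [Module.Finite A P1] [Module.Projective A P1]
    [Module.Finite A P0] [Module.Projective A P0] (f : P1 →ₗ[A] P0)
    (hsurj : ∀ (Z : Type) [AddCommGroup Z] [Module A Z], T (ModuleCat.of A Z) →
      ∀ u : P1 →ₗ[A] Z, ∃ v : P0 →ₗ[A] Z, v.comp f = u)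
    (hinj : ∀ (Y : Type) [AddCommGroup Y] [Module A Y], rightPerp A T (ModuleCat.of A Y) →
      ∀ v : P0 →ₗ[A] Y, v.comp f = 0 → v = 0)
    (hlt : ∀ (Y : Type) [AddCommGroup Y] [Module A Y], rightPerp A T (ModuleCat.of A Y) →
      (∃ y : Y, y ≠ 0) → hd (A := A) K P0 Y < hd (A := A) K P1 Y) :
    ∃ N : ModuleCat.{0} A, rightPerp A T N ∧
      ∀ (Y : Type) [AddCommGroup Y] [Module A Y], rightPerp A T (ModuleCat.of A Y) →
        ∃ (k : ℕ) (g : Y →ₗ[A] (Fin k → N)), Function.Injective g := by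
  haveI := noeth (A := A) K
  haveI := artin (A := A) K
  haveI := DD.finite (A := A) K P1
  have hN : rightPerp A T (ModuleCat.of A (cog K f)) := by
    refine ⟨inferInstanceAs (Module.Finite A (cog K f)), fun Z hZ h => ?_⟩
    letI := kMod (A := A) K Z
    haveI := kTower (A := A) K Z
    obtain ⟨μ, hμ⟩ := DD.toFunctional K ((cog K f).subtype.comp h)
    obtain ⟨n, x, g, hx⟩ := dual_basis (A := A) P0
    have h0 : ∀ u, μ u = 0 := by
      intro u
      obtain ⟨v, rfl⟩ := hsurj Z hZ u
      have h1 : v.comp f = ∑ i, rm ((g i).comp f) (v (x i)) := by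
        conv_lhs => rw [rm_sum hx v]
        ext p
        simp [rm_apply, LinearMap.sum_apply]
      rw [h1, map_sum]
      refine Finset.sum_eq_zero fun i _ => ?_
      rw [hμ]
      exact (h (v (x i))).2 (g i)
    refine LinearMap.ext fun z => Subtype.ext (LinearMap.ext fun g' => ?_)
    exact (hμ g' z).symm.trans (h0 _)
  refine ⟨ModuleCat.of A (cog K f), hN, fun Y _ _ hY => ?_⟩
  haveI : Module.Finite A Y := hY.1
  obtain ⟨k, g, hg⟩ := exists_reject (A := A) (cog K f) Y
  refine ⟨k, g, ?_⟩
  rw [← LinearMap.ker_eq_bot]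
  by_contra hne
  letI := kMod (A := A) K Y
  haveI := kTower (A := A) K Y
  haveI := homFinite (A := A) K P0 Y
  haveI := homFinite (A := A) K P1 Y
  have hTF := rightPerp_isTorsionFree (T := T)
  have hY' : rightPerp A T (ModuleCat.of A (LinearMap.ker g)) :=
    hTF.of_inj hY (LinearMap.ker g).subtype (Submodule.injective_subtype _)
  have hlt' := hlt _ hY' (by
    obtain ⟨y, hy, hy0⟩ := Submodule.exists_mem_ne_zero_of_ne_bot hne
    exact ⟨⟨y, hy⟩, fun h => hy0 (congrArg Subtype.val h)⟩)
  rw [← finrank_homInto, ← finrank_homInto] at hlt'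
  have hnle : ¬ homInto K P1 (LinearMap.ker g) ≤ LinearMap.range (prec (X := Y) K f) := by
    intro hle
    have h1 : homInto K P1 (LinearMap.ker g) ≤
        (homInto K P0 (LinearMap.ker g)).map (prec (X := Y) K f) := by
      intro u hu
      obtain ⟨w, rfl⟩ := hle hu
      refine ⟨w, fun p => ?_, rfl⟩
      have h2 := hinj _ (hTF.pi hN k) (g.comp w) (LinearMap.ext fun q => hu q)
      exact LinearMap.congr_fun h2 p
    have h3 := Submodule.finrank_mono h1
    have h4 := Submodule.finrank_map_le (prec (X := Y) K f) (homInto K P0 (LinearMap.ker g))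
    omega
  obtain ⟨u, hu, hu'⟩ := SetLike.not_le_iff_exists.1 hnle
  obtain ⟨μ, hμ, hle⟩ := Submodule.exists_le_ker_of_notMem hu'
  obtain ⟨h, hh⟩ := DD.ofFunctional K μ
  have hmem : ∀ y, h y ∈ cog K f := fun y g' => by
    rw [hh]
    exact hle ⟨rm g' y, rfl⟩
  obtain ⟨n, x, g', hx⟩ := dual_basis (A := A) P1
  apply hμ
  rw [rm_sum hx u, map_sum]
  refine Finset.sum_eq_zero fun i _ => ?_
  rw [← hh]
  have h5 := hg (h.codRestrict _ hmem) (hu (x i))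
  have h6 : h (u (x i)) = 0 := congrArg Subtype.val h5
  rw [h6]
  rfl

end Cogen

set_option linter.style.haveILetI false
set_option linter.unusedSectionVars false
section Backward
variable {A : Type} [Ring A] {T : ModuleCat.{0} A → Prop}

theorem exists_min_approx (K : Type) [Field K] [Algebra K A] [FiniteDimensional K A]
    (hT : IsTorsionClass A T) (hff : FunctoriallyFinite A T) :
    ∃ (X : ModuleCat.{0} A) (α : A →ₗ[A] X), T X ∧
      (∀ (Y : Type) [AddCommGroup Y] [Module A Y], T (ModuleCat.of A Y) →
        ∀ g : A →ₗ[A] Y, ∃ h : X →ₗ[A] Y, h.comp α = g) ∧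
      ∀ h : X →ₗ[A] X, h.comp α = α → Function.Bijective h := by
  haveI := noeth (A := A) K
  haveI := artin (A := A) K
  let S : Set ℕ := {n | ∃ (X : ModuleCat.{0} A) (α : A →ₗ[A] X), T X ∧
      (∀ (Y : Type) [AddCommGroup Y] [Module A Y], T (ModuleCat.of A Y) →
        ∀ g : A →ₗ[A] Y, ∃ h : X →ₗ[A] Y, h.comp α = g) ∧ hd (A := A) K A X = n}
  have hS : S.Nonempty := by
    obtain ⟨X, α, hX, hα⟩ := hff.1 (ModuleCat.of A A) (inferInstanceAs (Module.Finite A A))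
    exact ⟨_, X, α, hX, fun Y _ _ hY g => hα (ModuleCat.of A Y) hY g, rfl⟩
  obtain ⟨n, ⟨X, α, hX, hα, hn⟩, hmin⟩ := (wellFounded_lt (α := ℕ)).has_min S hS
  haveI : Module.Finite A X := hT.fin X hX
  refine ⟨X, α, hX, hα, fun h hh => ?_⟩
  have hle : n ≤ hd (A := A) K A (LinearMap.range h) := by
    by_contra hc
    refine hmin _ ⟨ModuleCat.of A (LinearMap.range h), h.rangeRestrict.comp α,
      hT.of_range (X := X) hX h, fun Y _ _ hY g => ?_, rfl⟩ (not_le.1 hc)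
    obtain ⟨k, hk⟩ := hα Y hY g
    refine ⟨k.comp (LinearMap.range h).subtype, ?_⟩
    rw [← hk]
    conv_rhs => rw [← hh]
    rfl
  have h1 := hd_sub_quot (A := A) K (P := A) (LinearMap.range h)
  have h2 : hd (A := A) K A (X ⧸ LinearMap.range h) = 0 := by omega
  rw [hd_ring_zero_iff] at h2
  have hs : Function.Surjective h := fun x =>
    (Submodule.Quotient.mk_eq_zero _).1 (h2 (Submodule.Quotient.mk x))
  exact IsArtinian.bijective_of_injective_endomorphism _
      (IsNoetherian.injective_of_surjective_endomorphism _ hs)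

theorem split_of_min {X : Type} [AddCommGroup X] [Module A X] (α : A →ₗ[A] X)
    (hα : ∀ (Y : Type) [AddCommGroup Y] [Module A Y], T (ModuleCat.of A Y) →
        ∀ g : A →ₗ[A] Y, ∃ h : X →ₗ[A] Y, h.comp α = g)
    (hb : ∀ h : X →ₗ[A] X, h.comp α = α → Function.Bijective h)
    {E : Type} [AddCommGroup E] [Module A E] (hE : T (ModuleCat.of A E)) (q : E →ₗ[A] X)
    (hq : Function.Surjective q) : ∃ k : X →ₗ[A] E, q.comp k = LinearMap.id := by
  obtain ⟨a, ha⟩ := Module.projective_lifting_property q α hq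
  obtain ⟨k, hk⟩ := hα E hE a
  have h1 : (q.comp k).comp α = α := by rw [LinearMap.comp_assoc, hk, ha]
  let e := LinearEquiv.ofBijective _ (hb _ h1)
  refine ⟨k.comp e.symm.toLinearMap, LinearMap.ext fun x => ?_⟩
  exact e.apply_symm_apply x

theorem extend_of_split (hT : IsTorsionClass A T) {X : Type} [AddCommGroup X] [Module A X]
    (hX : T (ModuleCat.of A X))
    (hsplit : ∀ (E : Type) [AddCommGroup E] [Module A E], T (ModuleCat.of A E) →
      ∀ q : E →ₗ[A] X, Function.Surjective q → ∃ k : X →ₗ[A] E, q.comp k = LinearMap.id)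
    {P0 Z : Type} [AddCommGroup P0] [Module A P0] [AddCommGroup Z] [Module A Z]
    [Module.Finite A P0] [Module.Projective A P0]
    (π : P0 →ₗ[A] X) (hπ : Function.Surjective π) (hZ : T (ModuleCat.of A Z))
    (s : LinearMap.ker π →ₗ[A] Z) :
    ∃ w : P0 →ₗ[A] Z, ∀ x : LinearMap.ker π, w x = s x := by
  haveI := hT.fin' hZ
  let G : Submodule A (Z × P0) := LinearMap.range ((-s).prod (LinearMap.ker π).subtype)
  let i : Z →ₗ[A] (Z × P0) ⧸ G := G.mkQ.comp (LinearMap.inl A Z P0)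
  let j : P0 →ₗ[A] (Z × P0) ⧸ G := G.mkQ.comp (LinearMap.inr A Z P0)
  have hGq : G ≤ LinearMap.ker (π.comp (LinearMap.snd A Z P0)) := by
    rintro _ ⟨x, rfl⟩
    exact x.2
  let q : ((Z × P0) ⧸ G) →ₗ[A] X := G.liftQ (π.comp (LinearMap.snd A Z P0)) hGq
  have hq : Function.Surjective q := fun x => by
    obtain ⟨p, rfl⟩ := hπ x
    exact ⟨j p, rfl⟩
  have hij : ∀ x : LinearMap.ker π, j x = i (s x) := by
    intro x
    refine (Submodule.Quotient.eq G).2 ⟨x, ?_⟩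
    simp
  have hi : Function.Injective i := by
    rw [← LinearMap.ker_eq_bot, eq_bot_iff]
    intro z hz
    obtain ⟨x, hx⟩ := (Submodule.Quotient.mk_eq_zero G).1 hz
    have h1 : (x : P0) = 0 := congrArg Prod.snd hx
    have h2 : -s x = z := congrArg Prod.fst hx
    have h3 : x = 0 := Subtype.ext h1
    rw [h3, map_zero, neg_zero] at h2
    exact h2.symm
  have hiq : LinearMap.range i = LinearMap.ker q := by
    ext e
    constructor
    · rintro ⟨z, rfl⟩
      change π 0 = 0
      exact map_zero π
    · intro he
      obtain ⟨⟨z, p⟩, rfl⟩ := G.mkQ_surjective e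
      have hp : p ∈ LinearMap.ker π := he
      refine ⟨z + s ⟨p, hp⟩, ?_⟩
      rw [map_add, ← hij]
      change G.mkQ (z, 0) + G.mkQ (0, p) = _
      rw [← map_add]
      simp
  have hE : T (ModuleCat.of A ((Z × P0) ⧸ G)) := hT.of_exact hZ hX i q hq hiq
  obtain ⟨k, hk⟩ := hsplit _ hE q hq
  obtain ⟨w, hw⟩ := lift_range i (j - k.comp π) fun p => by
    rw [hiq, LinearMap.mem_ker, LinearMap.sub_apply, map_sub]
    have h1 : q (k (π p)) = π p := LinearMap.congr_fun hk _
    have h2 : q (j p) = π p := rfl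
    change q (j p) - q (k (π p)) = 0
    rw [h1, h2, sub_self]
  refine ⟨w, fun x => hi ?_⟩
  have h1 : i (w x) = j x - k (π x) := LinearMap.congr_fun hw x
  have h2 : π x = 0 := x.2
  rw [h2, map_zero, sub_zero] at h1
  rw [h1, hij]

/-- The minimal presentation of the Ext-projective generator. -/
theorem exists_pres (K : Type) [Field K] [Algebra K A] [FiniteDimensional K A]
    (hT : IsTorsionClass A T) {X : Type} [AddCommGroup X] [Module A X]
    (hX : T (ModuleCat.of A X))
    (hsplit : ∀ (E : Type) [AddCommGroup E] [Module A E], T (ModuleCat.of A E) →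
      ∀ q : E →ₗ[A] X, Function.Surjective q → ∃ k : X →ₗ[A] E, q.comp k = LinearMap.id) :
    ∃ (P1 P0 : ModuleCat.{0} A) (p : P1 →ₗ[A] P0) (π : P0 →ₗ[A] X), Module.Finite A P1 ∧
      Module.Projective A P1 ∧ Module.Finite A P0 ∧ Module.Projective A P0 ∧
      Function.Surjective π ∧ LinearMap.range p = LinearMap.ker π ∧
      ∀ (Z : Type) [AddCommGroup Z] [Module A Z], T (ModuleCat.of A Z) →
        ∀ f : P1 →ₗ[A] Z, ∃ g : P0 →ₗ[A] Z, g.comp p = f := by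
  haveI := noeth (A := A) K
  haveI := hT.fin' hX
  obtain ⟨n, π, hπ⟩ := Module.Finite.exists_fin' A X
  obtain ⟨P1, c, hfin, hproj, hc, hess⟩ := exists_cover (A := A) K (LinearMap.ker π)
  let p : P1 →ₗ[A] (Fin n → A) := (LinearMap.ker π).subtype.comp c
  refine ⟨P1, ModuleCat.of A (Fin n → A), p, π, hfin, hproj,
    inferInstanceAs (Module.Finite A (Fin n → A)),
    inferInstanceAs (Module.Projective A (Fin n → A)), hπ, ?_, ?_⟩
  · change LinearMap.range ((LinearMap.ker π).subtype.comp c) = _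
    rw [LinearMap.range_comp_of_range_eq_top _ (LinearMap.range_eq_top.2 hc),
      Submodule.range_subtype]
  · intro Z _ _ hZ f
    let V : Submodule A Z := (LinearMap.ker c).map f
    have hV : T (ModuleCat.of A (Z ⧸ V)) := hT.of_surj hZ V.mkQ V.mkQ_surjective
    obtain ⟨s, hs⟩ := descend c hc (V.mkQ.comp f) (by
      intro x hx
      exact (Submodule.Quotient.mk_eq_zero V).2 ⟨x, hx, rfl⟩)
    obtain ⟨w, hw⟩ := extend_of_split hT hX hsplit π hπ hV s
    obtain ⟨g, hg⟩ := Module.projective_lifting_property V.mkQ w V.mkQ_surjective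
    refine ⟨g, ?_⟩
    let f' : P1 →ₗ[A] Z := f - g.comp p
    have h1 : ∀ x, f' x ∈ V := by
      intro x
      refine (Submodule.Quotient.mk_eq_zero V).1 ?_
      change V.mkQ (f x - g (p x)) = 0
      have h2 : V.mkQ (g (p x)) = w (p x) := LinearMap.congr_fun hg _
      have h3 : w (p x) = s (c x) := hw (c x)
      have h4 : s (c x) = V.mkQ (f x) := LinearMap.congr_fun hs x
      rw [map_sub, h2, h3, h4, sub_self]
    have h5 : LinearMap.ker f' = ⊤ := by
      apply hess
      rw [eq_top_iff]
      rintro y -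
      obtain ⟨x, rfl⟩ := hc y
      obtain ⟨k, hk, hkx⟩ := h1 x
      have hck : c k = 0 := hk
      refine ⟨x - k, ?_, by rw [map_sub, hck, sub_zero]⟩
      change f' (x - k) = 0
      have hpk : p k = 0 := congrArg Subtype.val hck
      have : f' k = f k := by
        change f k - g (p k) = f k
        rw [hpk, map_zero, sub_zero]
      rw [map_sub, this, hkx, sub_self]
    rw [LinearMap.ker_eq_top] at h5
    exact (sub_eq_zero.1 h5).symm

theorem backward (K : Type) [Field K] [Algebra K A] [FiniteDimensional K A]
    (hT : IsTorsionClass A T) (hff : FunctoriallyFinite A T) :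
    IsBicompactTors A T ∧ NumericallyDisjoint A T (rightPerp A T) := by
  haveI := noeth (A := A) K
  haveI := artin (A := A) K
  obtain ⟨X, α, hX, hα, hb⟩ := exists_min_approx K hT hff
  haveI : Module.Finite A X := hT.fin X hX
  have hsplit : ∀ (E : Type) [AddCommGroup E] [Module A E], T (ModuleCat.of A E) →
      ∀ q : E →ₗ[A] X, Function.Surjective q → ∃ k : X →ₗ[A] E, q.comp k = LinearMap.id :=
    fun E _ _ hE q hq => split_of_min α hα hb hE q hq
  obtain ⟨P1, P0, p, π, hf1, hp1, hf0, hp0, hπ, hpπ, hext⟩ := exists_pres K hT (X := X) hX hsplit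
  have hπp : π.comp p = 0 := LinearMap.ext fun x => by
    have : p x ∈ LinearMap.ker π := hpπ ▸ ⟨x, rfl⟩
    exact this
  -- injectivity on the torsion-free class
  have hinj : ∀ (Y : Type) [AddCommGroup Y] [Module A Y], rightPerp A T (ModuleCat.of A Y) →
      ∀ v : P0 →ₗ[A] Y, v.comp p = 0 → v = 0 := by
    intro Y _ _ hY v hv
    obtain ⟨w, hw⟩ := descend π hπ v (by
      intro x hx
      have hx' : x ∈ LinearMap.range p := hpπ ▸ hx
      obtain ⟨y, rfl⟩ := hx'
      exact LinearMap.congr_fun hv y)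
    rw [← hw, hY.zero_of (X := X) hX w, LinearMap.zero_comp]
  have hle : ∀ (Y : Type) [AddCommGroup Y] [Module A Y], rightPerp A T (ModuleCat.of A Y) →
      hd (A := A) K P0 Y ≤ hd (A := A) K P1 Y := by
    intro Y _ _ hY
    haveI : Module.Finite A Y := hY.1
    by_contra hc
    obtain ⟨v, hv, hv'⟩ := exists_kernel K p (not_le.1 hc)
    exact hv (hinj Y hY v hv')
  refine ⟨⟨⟨X, inferInstance, ?_⟩, ?_⟩, ?_⟩
  · funext Y
    refine propext ⟨fun hY T' hT' hXT' => ?_, fun hY => hY T hT fun Z hZ => hZ ▸ hX⟩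
    haveI : Module.Finite A Y := hT.fin Y hY
    obtain ⟨k, g, hg⟩ := exists_trace (A := A) X Y
    have hs : Function.Surjective g := fun y => by
      obtain ⟨h, hh⟩ := hα Y hY (LinearMap.toSpanSingleton A Y y)
      refine hg h ⟨α 1, ?_⟩
      have := LinearMap.congr_fun hh 1
      simpa using this
    exact hT'.of_surj (hT'.pi (L := X) (hXT' X rfl) k) g hs
  · obtain ⟨a, ha⟩ := Module.projective_lifting_property π α hπ
    obtain ⟨N, hN, hemb⟩ := exists_cogen (T := T) K (p.coprod a) (by
      intro Z _ _ hZ u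
      obtain ⟨g, hg⟩ := hext Z hZ (u.comp (LinearMap.inl A P1 A))
      obtain ⟨h, hh⟩ := hα Z hZ (u.comp (LinearMap.inr A P1 A) - g.comp a)
      refine ⟨g + h.comp π, ?_⟩
      refine LinearMap.prod_ext ?_ ?_
      · rw [LinearMap.comp_assoc, LinearMap.coprod_inl, LinearMap.add_comp, hg,
          LinearMap.comp_assoc, hπp, LinearMap.comp_zero, add_zero]
      · rw [LinearMap.comp_assoc, LinearMap.coprod_inr, LinearMap.add_comp,
          LinearMap.comp_assoc, ha, hh]
        abel) (by
      intro Y _ _ hY v hv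
      refine hinj Y hY v ?_
      have := congrArg (fun t => t.comp (LinearMap.inl A P1 A)) hv
      simpa [LinearMap.comp_assoc] using this) (by
      intro Y _ _ hY hne
      haveI : Module.Finite A Y := hY.1
      have h1 := hle Y hY
      rw [hd_prod_left]
      have h2 : hd (A := A) K A Y ≠ 0 := by
        rw [Ne, hd_ring_zero_iff]
        intro h
        obtain ⟨y, hy⟩ := hne
        exact hy (h y)
      omega)
    refine ⟨N, hN.1, ?_⟩
    funext Y
    refine propext ⟨fun hY F hF hNF => ?_, fun hY => hY _ rightPerp_isTorsionFree
      fun Z hZ => hZ ▸ hN⟩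
    obtain ⟨k, g, hg⟩ := hemb Y hY
    exact hF.of_inj (hF.pi (L := N) (hNF N rfl) k) g hg
  · rintro ⟨Z, Y, hZ, hY, ⟨z, hz⟩, -, hK⟩
    have h1 := hK (fun M => (hd (A := A) K P0 M : ℤ) - hd (A := A) K P1 M) (by
      intro L M N hL hM hN f g hf hg hfg
      have e0 := hd_add (A := A) K (P := P0) f g hf hg hfg
      have e1 := hd_add (A := A) K (P := P1) f g hf hg hfg
      simp only
      rw [e0, e1]
      push_cast
      ring)
    have h2 := hle Y hY
    have h3 : hd (A := A) K P1 Z < hd (A := A) K P0 Z := by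
      haveI : Module.Finite A Z := hT.fin Z hZ
      letI := kMod (A := A) K Z
      haveI := kTower (A := A) K Z
      haveI := homFinite (A := A) K P0 Z
      rw [hd_eq, hd_eq]
      have e1 := (prec (A := A) (X := Z) K p).finrank_range_add_finrank_ker
      have e2 : LinearMap.range (prec (A := A) (X := Z) K p) = ⊤ :=
        LinearMap.range_eq_top.2 fun u => hext Z hZ u
      rw [e2, finrank_top] at e1
      have e3 : Module.finrank K (LinearMap.ker (prec (A := A) (X := Z) K p)) ≠ 0 := by
        intro e4
        rw [Submodule.finrank_eq_zero] at e4
        obtain ⟨h, hh⟩ := hα Z hZ (LinearMap.toSpanSingleton A Z z)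
        have e5 : h.comp π ∈ LinearMap.ker (prec (A := A) (X := Z) K p) := by
          change (h.comp π).comp p = 0
          rw [LinearMap.comp_assoc, hπp, LinearMap.comp_zero]
        rw [e4, Submodule.mem_bot] at e5
        obtain ⟨q, hq⟩ := hπ (α 1)
        have e6 : h (α 1) = z := by
          have := LinearMap.congr_fun hh 1
          simpa using this
        apply hz
        rw [← e6, ← hq]
        exact LinearMap.congr_fun e5 q
      omega
    omega

end Backward

/-- A torsion class is bicompact and numerically disjoint if and only if
it is functorially finite. -/
theorem stmt1 (K : Type) [Field K] [Algebra K A] [FiniteDimensional K A]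
    (T : ModuleCat.{0} A → Prop) (hT : IsTorsionClass A T) :
    (IsBicompactTors A T ∧ NumericallyDisjoint A T (rightPerp A T)) ↔
      FunctoriallyFinite A T := by
  exact ⟨fun h => forward K hT h.1 h.2, backward K hT⟩
end TorsPaper
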